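/- arXiv:1001.0684 — 2 statements merged into one kernel-verified Lean document; each statement's English description precedes it below -/
import Mathlib

section
/- (Lewis & Schuur, 1973) Fix integers n ≥ 3, d ≥ 1 and e ≥ 1. There exists a real constant A = A(d,e) with the following property: for every finite field 𝔽_q of cardinality q > A, every absolutely irreducible homogeneous polynomial G ∈ 𝔽_q[x_1,…,x_n] of total degree d, and every homogeneous polynomial H ∈ 𝔽_q[x_1,…,x_n] of total degree e not divisible by G, there exists a point x ∈ 𝔽_q^n which is a non-singular zero of G (i.e. G(x) = 0 and ∇G(x) ≠ 0) and which satisfies H(x) ≠ 0. -/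
open MvPolynomial
open scoped TensorProduct

/-- The number of monomials of degree at most `N` in `r` variables. -/
def monomialCount (r N : ℕ) : ℕ := Nat.multichoose (r + 1) N

noncomputable instance fintypeDegreeLE (r N : ℕ) :
    Fintype {α : Fin r →₀ ℕ // α.degree ≤ N} :=
  Fintype.subtype ((Finset.range (N + 1)).biUnion
    fun n => Finset.finsuppAntidiag (Finset.univ : Finset (Fin r)) n) (by
      intro α
      simp [Finset.mem_finsuppAntidiag, Finsupp.degree_eq_sum])

theorem sum_range_multichoose (r N : ℕ) :
    ∑ n ∈ Finset.range (N + 1), Nat.multichoose r n = Nat.multichoose (r + 1) N := by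
  induction N with
  | zero => simp
  | succ N ih => rw [Finset.sum_range_succ, ih, Nat.multichoose_succ_succ, add_comm]

theorem card_degree_le (r N : ℕ) :
    Fintype.card {α : Fin r →₀ ℕ // α.degree ≤ N} = monomialCount r N := by
  rw [fintypeDegreeLE, Fintype.subtype_card, Finset.card_biUnion]
  · simp only [Finset.card_finsuppAntidiag_nat_eq_multichoose, Finset.card_univ, Fintype.card_fin]
    exact sum_range_multichoose r N
  · intro a _ b _ hab
    rw [Function.onFun, Finset.disjoint_left]
    intro α ha hb
    rw [Finset.mem_finsuppAntidiag] at ha hb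
    exact hab (ha.1.symm.trans hb.1)

theorem monomialCount_pos (r N : ℕ) : 0 < monomialCount r N := by
  rw [monomialCount, Nat.multichoose_eq]
  exact Nat.choose_pos (by omega)

theorem monomialCount_succ (r N : ℕ) :
    monomialCount r (N + 1) * (N + 1) = monomialCount r N * (N + 1 + r) := by
  simp only [monomialCount, Nat.multichoose_eq]
  have h := Nat.add_one_mul_choose_eq (r + N) N
  rw [show r + 1 + (N + 1) - 1 = r + N + 1 by omega, show r + 1 + N - 1 = r + N by omega, ← h]
  ring

open Filter Topology in
theorem tendsto_monomialCount_ratio (r c : ℕ) :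
    Tendsto (fun N => (monomialCount r (N + c) : ℝ) / monomialCount r N) atTop (𝓝 1) := by
  have hpos : ∀ N, (0 : ℝ) < monomialCount r N := fun N => by exact_mod_cast monomialCount_pos r N
  have h1 : Tendsto (fun N => (monomialCount r (N + 1) : ℝ) / monomialCount r N) atTop (𝓝 1) := by
    have h2 : (fun N : ℕ => (monomialCount r (N + 1) : ℝ) / monomialCount r N)
        = fun N : ℕ => 1 + (r : ℝ) / ((N : ℝ) + 1) := by
      funext N
      have h3 : (monomialCount r (N + 1) : ℝ) * (N + 1) = monomialCount r N * (N + 1 + r) := by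
        exact_mod_cast monomialCount_succ r N
      have h4 : (0 : ℝ) < (N : ℝ) + 1 := by positivity
      have := hpos N
      field_simp
      linarith
    rw [h2]
    have h5 := (tendsto_const_div_atTop_nhds_zero_nat (r : ℝ)).comp (tendsto_add_atTop_nat 1)
    have := h5.const_add 1
    simpa [Function.comp_def] using this
  induction c with
  | zero =>
    have : (fun N => (monomialCount r (N + 0) : ℝ) / monomialCount r N) = fun _ => 1 := by
      funext N
      simp [(hpos N).ne']
    rw [this]
    exact tendsto_const_nhds
  | succ c ih =>
    have h := (h1.comp (tendsto_add_atTop_nat c)).mul ih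
    rw [one_mul] at h
    refine h.congr fun N => ?_
    have := hpos (N + c)
    simp only [Function.comp]
    rw [← add_assoc]
    field_simp

theorem exists_monomialCount_lt (r c N₀ : ℕ) {ε : ℝ} (hε : 1 < ε) :
    ∃ N ≥ N₀, (monomialCount r (N + c) : ℝ) < ε * monomialCount r N := by
  have h := (tendsto_monomialCount_ratio r c).eventually (gt_mem_nhds hε)
  obtain ⟨N, h1, h2⟩ := (h.and (Filter.eventually_ge_atTop N₀)).exists
  refine ⟨N, h2, ?_⟩
  have hpos : (0 : ℝ) < monomialCount r N := by exact_mod_cast monomialCount_pos r N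
  rwa [div_lt_iff₀ hpos] at h1

/-- Two-stage choice of the degrees in the auxiliary construction. -/
theorem exists_degree_parameters (r d : ℕ) (hd : 1 ≤ d) :
    ∃ K B D : ℕ, K ≤ B ∧
      monomialCount r (B + K + 2 * d + 2 * (K + d + 1)) * d * (monomialCount r (K + d) * d) <
        monomialCount r B * d * (monomialCount r K * d) +
          monomialCount r (K + d) *
            (monomialCount r (B + K + 2 * d + 2 * (K + d + 1)) * d) ∧
      (monomialCount r (D + B + 2 * d) * d) * (monomialCount r (D + B + 2 * d) * d) <
        (monomialCount r D * d) * (monomialCount r D * d) +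
          monomialCount r (D + B + 2 * d) * monomialCount r (D + B + 2 * d) := by
  have hpos : ∀ N, (0 : ℝ) < monomialCount r N := fun N => by exact_mod_cast monomialCount_pos r N
  have hd' : (1 : ℝ) ≤ d := by exact_mod_cast hd
  have key : ∃ ε : ℝ, 1 < ε ∧ (d - 1) * ε * ε < d ∧ (d ^ 2 - 1) * (ε * ε) < d ^ 2 := by
    refine ⟨1 + 1 / (4 * d ^ 2), ?_, ?_, ?_⟩
    · have : (0 : ℝ) < 1 / (4 * d ^ 2) := by positivity
      linarith
    all_goals
      set t : ℝ := 1 / (4 * d ^ 2) with ht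
      have h1 : t * d ^ 2 = 1 / 4 := by rw [ht]; field_simp
      have h0 : 0 < t := by positivity
      have h3 : (1 : ℝ) ≤ d ^ 2 := one_le_pow₀ hd'
      have h2 : t ≤ 1 / 4 := by nlinarith [mul_le_mul_of_nonneg_left h3 h0.le]
      have h4 : t * d ≤ 1 / 4 := by nlinarith [mul_nonneg h0.le (sub_nonneg.2 hd')]
      have h5 : t * t * d ≤ t * (1 / 4) := by nlinarith
      have h6 : t * t * d ^ 2 = t * (1 / 4) := by rw [mul_assoc, h1]
      nlinarith [mul_nonneg h0.le h0.le]
  obtain ⟨ε, hε, h1, h2⟩ := key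
  obtain ⟨K, -, hK⟩ := exists_monomialCount_lt r d 0 hε
  obtain ⟨B, hB, hB'⟩ := exists_monomialCount_lt r (K + 2 * d + 2 * (K + d + 1)) K hε
  obtain ⟨D, -, hD⟩ := exists_monomialCount_lt r (B + 2 * d) 0 hε
  refine ⟨K, B, D, hB, ?_, ?_⟩
  · rw [show B + K + 2 * d + 2 * (K + d + 1) = B + (K + 2 * d + 2 * (K + d + 1)) by ring]
    have e1 := hpos (K + d)
    have e2 := hpos (B + (K + 2 * d + 2 * (K + d + 1)))
    have e3 := hpos K
    have e4 := hpos B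
    generalize (monomialCount r (B + (K + 2 * d + 2 * (K + d + 1)))) = b' at *
    generalize (monomialCount r (K + d)) = k' at *
    generalize (monomialCount r K) = k at *
    generalize (monomialCount r B) = b at *
    have : (b' * d * (k' * d) : ℝ) < b * d * (k * d) + k' * (b' * d) := by
      have h3 : (b' * k' : ℝ) ≤ (ε * b) * (ε * k) :=
        mul_le_mul hB'.le hK.le e1.le (by positivity)
      have h4 : (d - 1) * (b' * k' : ℝ) ≤ (d - 1) * ((ε * b) * (ε * k)) :=
        mul_le_mul_of_nonneg_left h3 (by linarith)
      have h5 : (d - 1) * ε * ε * (b * k) < d * (b * k : ℝ) :=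
        mul_lt_mul_of_pos_right h1 (by positivity)
      have h6 : (d - 1) * (b' * k' : ℝ) < d * (b * k : ℝ) := by nlinarith
      have h7 : (d : ℝ) * ((d - 1) * (b' * k' : ℝ)) < d * (d * (b * k : ℝ)) :=
        mul_lt_mul_of_pos_left h6 (by linarith)
      nlinarith
    exact_mod_cast this
  · rw [show D + B + 2 * d = D + (B + 2 * d) by ring]
    have e1 := hpos (D + (B + 2 * d))
    have e2 := hpos D
    generalize (monomialCount r (D + (B + 2 * d))) = b' at *
    generalize (monomialCount r D) = b at *
    have : ((b' * d) * (b' * d) : ℝ) < (b * d) * (b * d) + b' * b' := by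
      have h3 : (b' * b' : ℝ) ≤ (ε * b) * (ε * b) :=
        mul_le_mul hD.le hD.le e1.le (by positivity)
      have h4 : (d ^ 2 - 1) * (b' * b' : ℝ) ≤ (d ^ 2 - 1) * ((ε * b) * (ε * b)) :=
        mul_le_mul_of_nonneg_left h3 (by nlinarith)
      have h5 : (d ^ 2 - 1) * (ε * ε) * (b * b) < d ^ 2 * (b * b : ℝ) :=
        mul_lt_mul_of_pos_right h2 (by positivity)
      nlinarith
    exact_mod_cast this

section Filtration

variable {k A : Type*} [Field k] [CommRing A] [Algebra k A] {r : ℕ}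

/-- The monomial `x ^ α`. -/
def varMonomial (x : Fin r → A) (α : Fin r →₀ ℕ) : A := ∏ i, x i ^ α i

theorem varMonomial_zero (x : Fin r → A) : varMonomial x 0 = 1 := by simp [varMonomial]

theorem varMonomial_add (x : Fin r → A) (α β : Fin r →₀ ℕ) :
    varMonomial x (α + β) = varMonomial x α * varMonomial x β := by
  simp [varMonomial, pow_add, Finset.prod_mul_distrib]

theorem varMonomial_single (x : Fin r → A) (i : Fin r) :
    varMonomial x (Finsupp.single i 1) = x i := by
  classical
  rw [varMonomial, Finset.prod_eq_single i]
  · simp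
  · intro j _ hj
    simp [Finsupp.single_eq_of_ne hj]
  · simp

theorem varMonomial_map {B F : Type*} [CommRing B] [FunLike F A B] [RingHomClass F A B] (g : F)
    (x : Fin r → A) (α : Fin r →₀ ℕ) :
    g (varMonomial x α) = varMonomial (fun i => g (x i)) α := by
  simp [varMonomial, map_prod, map_pow]

theorem varMonomial_pow (x : Fin r → A) (q : ℕ) (α : Fin r →₀ ℕ) :
    varMonomial (fun i => x i ^ q) α = varMonomial x (q • α) := by
  simp [varMonomial, pow_mul]

theorem induction_varMonomial {P : (Fin r →₀ ℕ) → Prop} (h0 : P 0)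
    (h1 : ∀ i α, P α → P (Finsupp.single i 1 + α)) (α : Fin r →₀ ℕ) : P α := by
  have hn : ∀ i n α, P α → P (Finsupp.single i n + α) := by
    intro i n
    induction n with
    | zero => intro α h; simpa using h
    | succ n ih =>
      intro α h
      rw [add_comm n 1, Finsupp.single_add, add_assoc]
      exact h1 _ _ (ih _ h)
  induction α using Finsupp.induction with
  | zero => exact h0
  | single_add a b f _ _ ih => exact hn _ _ _ ih

variable (k) in
/-- The span of the reduced monomials `x ^ α * y ^ j`, `j < d`, of total degree at most `N`. -/
def degreeFiltration (x : Fin r → A) (y : A) (d N : ℕ) : Submodule k A :=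
  Submodule.span k {z | ∃ (α : Fin r →₀ ℕ) (j : ℕ), j < d ∧ α.degree + j ≤ N ∧
    z = varMonomial x α * y ^ j}

variable (k) in
/-- The span of the reduced monomials `x ^ α * y ^ j`, `j < d`, with `α` of degree at most `N`. -/
def baseFiltration (x : Fin r → A) (y : A) (d N : ℕ) : Submodule k A :=
  Submodule.span k (Set.range fun p : {α : Fin r →₀ ℕ // α.degree ≤ N} × Fin d =>
    varMonomial x p.1 * y ^ (p.2 : ℕ))

instance (x : Fin r → A) (y : A) (d N : ℕ) : FiniteDimensional k (baseFiltration k x y d N) :=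
  FiniteDimensional.span_of_finite k (Set.finite_range _)

variable {x : Fin r → A} {y : A} {d : ℕ}

theorem monomial_mem_degreeFiltration {α : Fin r →₀ ℕ} {j N : ℕ} (hj : j < d)
    (h : α.degree + j ≤ N) : varMonomial x α * y ^ j ∈ degreeFiltration k x y d N :=
  Submodule.subset_span ⟨α, j, hj, h, rfl⟩

theorem degreeFiltration_mono {N M : ℕ} (h : N ≤ M) :
    degreeFiltration k x y d N ≤ degreeFiltration k x y d M :=
  Submodule.span_mono fun _ ⟨α, j, hj, hN, hz⟩ => ⟨α, j, hj, hN.trans h, hz⟩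

theorem baseFiltration_mono {N M : ℕ} (h : N ≤ M) :
    baseFiltration k x y d N ≤ baseFiltration k x y d M := by
  refine Submodule.span_mono ?_
  rintro _ ⟨⟨⟨α, hα⟩, j⟩, rfl⟩
  exact ⟨⟨⟨α, hα.trans h⟩, j⟩, rfl⟩

theorem degreeFiltration_le_baseFiltration (N : ℕ) :
    degreeFiltration k x y d N ≤ baseFiltration k x y d N := by
  refine Submodule.span_le.2 ?_
  rintro _ ⟨α, j, hj, hN, rfl⟩
  exact Submodule.subset_span ⟨⟨⟨α, by omega⟩, ⟨j, hj⟩⟩, rfl⟩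

theorem baseFiltration_le_degreeFiltration (N : ℕ) :
    baseFiltration k x y d N ≤ degreeFiltration k x y d (N + d) := by
  refine Submodule.span_le.2 ?_
  rintro _ ⟨⟨⟨α, hα⟩, j⟩, rfl⟩
  exact monomial_mem_degreeFiltration j.2 (by have := j.2; simp only; omega)

theorem varMonomial_mul_mem {α : Fin r →₀ ℕ} {N : ℕ} {z : A}
    (hz : z ∈ degreeFiltration k x y d N) :
    varMonomial x α * z ∈ degreeFiltration k x y d (α.degree + N) := by
  induction hz using Submodule.span_induction with
  | mem z h =>
    obtain ⟨β, j, hj, hN, rfl⟩ := h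
    rw [← mul_assoc, ← varMonomial_add]
    exact monomial_mem_degreeFiltration hj (by simp; omega)
  | zero => simp
  | add a b _ _ ha hb => rw [mul_add]; exact add_mem ha hb
  | smul c a _ ha => rw [mul_smul_comm]; exact Submodule.smul_mem _ _ ha

theorem y_mul_mem (hy : y ^ d ∈ degreeFiltration k x y d d) {N : ℕ} {z : A}
    (hz : z ∈ degreeFiltration k x y d N) :
    y * z ∈ degreeFiltration k x y d (N + 1) := by
  induction hz using Submodule.span_induction with
  | mem z h =>
    obtain ⟨β, j, hj, hN, rfl⟩ := h
    rw [mul_left_comm, ← pow_succ']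
    rcases Nat.lt_or_ge (j + 1) d with h | h
    · exact monomial_mem_degreeFiltration h (by omega)
    · obtain rfl : d = j + 1 := by omega
      exact degreeFiltration_mono (by omega) (varMonomial_mul_mem hy)
  | zero => simp
  | add a b _ _ ha hb => rw [mul_add]; exact add_mem ha hb
  | smul c a _ ha => rw [mul_smul_comm]; exact Submodule.smul_mem _ _ ha

theorem y_pow_mul_mem (hy : y ^ d ∈ degreeFiltration k x y d d) {N : ℕ} {z : A}
    (hz : z ∈ degreeFiltration k x y d N) (j : ℕ) :
    y ^ j * z ∈ degreeFiltration k x y d (N + j) := by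
  induction j with
  | zero => simpa using hz
  | succ j ih => rw [pow_succ', mul_assoc]; exact y_mul_mem hy ih

theorem mul_mem_degreeFiltration (hy : y ^ d ∈ degreeFiltration k x y d d) {N M : ℕ} {z w : A}
    (hz : z ∈ degreeFiltration k x y d N) (hw : w ∈ degreeFiltration k x y d M) :
    z * w ∈ degreeFiltration k x y d (N + M) := by
  induction hz using Submodule.span_induction with
  | mem z h =>
    obtain ⟨β, j, hj, hN, rfl⟩ := h
    rw [mul_assoc]
    exact degreeFiltration_mono (by omega) (varMonomial_mul_mem (y_pow_mul_mem hy hw j))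
  | zero => simp
  | add a b _ _ ha hb => rw [add_mul]; exact add_mem ha hb
  | smul c a _ ha => rw [smul_mul_assoc]; exact Submodule.smul_mem _ _ ha

theorem one_mem_degreeFiltration (hd : 1 ≤ d) : (1 : A) ∈ degreeFiltration k x y d 0 := by
  have := monomial_mem_degreeFiltration (k := k) (x := x) (y := y) (d := d) (α := 0) (j := 0)
    (N := 0) hd (by simp)
  simpa [varMonomial_zero] using this

theorem pow_mem_degreeFiltration (hd : 1 ≤ d) (hy : y ^ d ∈ degreeFiltration k x y d d) {N : ℕ}
    {z : A} (hz : z ∈ degreeFiltration k x y d N) (n : ℕ) :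
    z ^ n ∈ degreeFiltration k x y d (n * N) := by
  induction n with
  | zero => simpa using one_mem_degreeFiltration hd
  | succ n ih =>
    rw [pow_succ, Nat.succ_mul]
    exact mul_mem_degreeFiltration hy ih hz

theorem aeval_mem_degreeFiltration (hd : 1 ≤ d) (hy : y ^ d ∈ degreeFiltration k x y d d)
    {N : ℕ} {p : MvPolynomial (Fin (r + 1)) k} (hp : p.totalDegree ≤ N) :
    aeval (Fin.cons y x : Fin (r + 1) → A) p ∈ degreeFiltration k x y d N := by
  rw [aeval_def, eval₂_eq']
  refine Submodule.sum_mem _ fun m hm => ?_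
  rw [← Algebra.smul_def]
  refine Submodule.smul_mem _ _ ?_
  have hm' : m.degree ≤ N := (le_totalDegree hm).trans hp
  rw [Fin.prod_univ_succ]
  simp only [Fin.cons_zero, Fin.cons_succ]
  have h1 := y_pow_mul_mem hy (varMonomial_mul_mem (α := m.tail)
    (one_mem_degreeFiltration (k := k) (x := x) (y := y) hd)) (m 0)
  rw [mul_one] at h1
  refine degreeFiltration_mono ?_ h1
  rw [Finsupp.degree_eq_sum, Fin.sum_univ_succ] at hm'
  rw [Finsupp.degree_eq_sum]
  simpa [Finsupp.tail_apply, add_comm] using hm'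

theorem finrank_baseFiltration
    (hind : LinearIndependent k fun p : (Fin r →₀ ℕ) × Fin d =>
      varMonomial x p.1 * y ^ (p.2 : ℕ)) (N : ℕ) :
    Module.finrank k (baseFiltration k x y d N) = monomialCount r N * d := by
  have h : LinearIndependent k fun p : {α : Fin r →₀ ℕ // α.degree ≤ N} × Fin d =>
      varMonomial x p.1 * y ^ (p.2 : ℕ) :=
    hind.comp (fun p : {α : Fin r →₀ ℕ // α.degree ≤ N} × Fin d => (p.1.1, p.2)) (by
      rintro ⟨⟨a, _⟩, j⟩ ⟨⟨b, _⟩, j'⟩ h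
      simpa using h)
  rw [baseFiltration, finrank_span_eq_card h, Fintype.card_prod, card_degree_le, Fintype.card_fin]

theorem baseFiltration_mul_mem (hy : y ^ d ∈ degreeFiltration k x y d d) {N M : ℕ} {z w : A}
    (hz : z ∈ baseFiltration k x y d N) (hw : w ∈ baseFiltration k x y d M) :
    z * w ∈ baseFiltration k x y d (N + M + 2 * d) := by
  refine degreeFiltration_le_baseFiltration _ (degreeFiltration_mono ?_
    (mul_mem_degreeFiltration hy (baseFiltration_le_degreeFiltration _ hz)
      (baseFiltration_le_degreeFiltration _ hw)))
  omega

end Filtration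

theorem LinearMap.exists_ne_zero_of_card_lt {k V W ι : Type*} [Field k] [AddCommGroup V]
    [Module k V] [FiniteDimensional k V] [AddCommGroup W] [Module k W] [Fintype ι]
    (f : V →ₗ[k] W) (v : ι → W) (hf : ∀ z, f z ∈ Submodule.span k (Set.range v))
    (h : Fintype.card ι < Module.finrank k V) : ∃ z, z ≠ 0 ∧ f z = 0 := by
  have : FiniteDimensional k (Submodule.span k (Set.range v)) :=
    FiniteDimensional.span_of_finite k (Set.finite_range _)
  have hk := LinearMap.ker_ne_bot_of_finrank_lt (f := f.codRestrict _ hf)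
    ((finrank_range_le_card v).trans_lt h)
  obtain ⟨z, hz, hz0⟩ := Submodule.exists_mem_ne_zero_of_ne_bot hk
  exact ⟨z, hz0, by simpa using congrArg Subtype.val (LinearMap.mem_ker.1 hz)⟩

section Auxiliary

variable {k A : Type*} [Field k] [CommRing A] [Algebra k A] {r : ℕ}

variable (k) in
/-- The element `1 ⊗ a - a ⊗ 1` of `A ⊗ A`. -/
def tensorDiff (a : A) : A ⊗[k] A := 1 ⊗ₜ[k] a - a ⊗ₜ[k] 1

variable (k) in
/-- The ideal of `A ⊗ A` generated by the elements `1 ⊗ x i - x i ⊗ 1`. -/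
def tensorDiffIdeal (x : Fin r → A) : Ideal (A ⊗[k] A) :=
  Ideal.span (Set.range fun i => tensorDiff k (x i))

theorem tensorDiff_mem {x : Fin r → A} (i : Fin r) :
    tensorDiff k (x i) ∈ tensorDiffIdeal k x :=
  Ideal.subset_span (Set.mem_range_self i)

variable (k) in
/-- The span of the products `(a ⊗ 1) * δ ^ α * (1 ⊗ y ^ l)` with `a` of degree at most `N`,
`δ i = 1 ⊗ x i - x i ⊗ 1` and `l < d`. -/
def taylorSpan (x : Fin r → A) (y : A) (d N : ℕ) : Submodule k (A ⊗[k] A) :=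
  Submodule.span k {z | ∃ a ∈ degreeFiltration k x y d N, ∃ (α : Fin r →₀ ℕ) (l : ℕ), l < d ∧
    z = (a ⊗ₜ[k] 1) * varMonomial (fun i => tensorDiff k (x i)) α * (1 ⊗ₜ[k] (y ^ l))}

variable {x : Fin r → A} {y : A} {d : ℕ}

theorem taylorSpan_mono {N M : ℕ} (h : N ≤ M) :
    taylorSpan k x y d N ≤ taylorSpan k x y d M :=
  Submodule.span_mono fun _ ⟨a, ha, α, l, hl, hz⟩ =>
    ⟨a, degreeFiltration_mono h ha, α, l, hl, hz⟩

theorem tmul_monomial_mem_taylorSpan (β : Fin r →₀ ℕ) :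
    ∀ (N : ℕ) (γ : Fin r →₀ ℕ) (a : A), a ∈ degreeFiltration k x y d N → ∀ l < d,
    (a ⊗ₜ[k] 1) * varMonomial (fun i => tensorDiff k (x i)) γ *
      (1 ⊗ₜ[k] (varMonomial x β * y ^ l)) ∈ taylorSpan k x y d (N + β.degree) := by
  induction β using induction_varMonomial with
  | h0 =>
    intro N γ a ha l hl
    rw [varMonomial_zero, one_mul]
    exact Submodule.subset_span ⟨a, by simpa using ha, γ, l, hl, rfl⟩
  | h1 i β ih =>
    intro N γ a ha l hl
    have e : (a ⊗ₜ[k] (1 : A)) * varMonomial (fun i => tensorDiff k (x i)) γ *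
        (1 ⊗ₜ[k] (varMonomial x (Finsupp.single i 1 + β) * y ^ l)) =
        ((x i * a) ⊗ₜ[k] (1 : A)) * varMonomial (fun i => tensorDiff k (x i)) γ *
          (1 ⊗ₜ[k] (varMonomial x β * y ^ l)) +
        (a ⊗ₜ[k] (1 : A)) * varMonomial (fun i => tensorDiff k (x i)) (γ + Finsupp.single i 1) *
          (1 ⊗ₜ[k] (varMonomial x β * y ^ l)) := by
      rw [varMonomial_add, varMonomial_add, varMonomial_single, varMonomial_single]
      have h1 : (1 : A) ⊗ₜ[k] (x i * varMonomial x β * y ^ l) =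
          (1 ⊗ₜ[k] x i) * (1 ⊗ₜ[k] (varMonomial x β * y ^ l)) := by
        simp [mul_assoc]
      have h2 : (x i * a) ⊗ₜ[k] (1 : A) = (a ⊗ₜ[k] 1) * (x i ⊗ₜ[k] 1) := by
        simp [mul_comm]
      rw [h1, h2, tensorDiff]
      ring
    rw [e]
    have hdeg : (Finsupp.single i 1 + β).degree = 1 + β.degree := by simp
    rw [hdeg]
    refine add_mem ?_ ?_
    · refine taylorSpan_mono (by omega) (ih (1 + N) γ _ ?_ l hl)
      have := varMonomial_mul_mem (α := Finsupp.single i 1) ha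
      rw [varMonomial_single] at this
      simpa using this
    · exact taylorSpan_mono (by omega) (ih N _ a ha l hl)

theorem tmul_mem_taylorSpan {N M : ℕ} {a b : A}
    (ha : a ∈ degreeFiltration k x y d N) (hb : b ∈ degreeFiltration k x y d M) :
    a ⊗ₜ[k] b ∈ taylorSpan k x y d (N + M) := by
  induction hb using Submodule.span_induction with
  | mem z h =>
    obtain ⟨β, j, hj, hN, rfl⟩ := h
    have := tmul_monomial_mem_taylorSpan β N 0 a ha j hj
    simp only [varMonomial_zero, mul_one, Algebra.TensorProduct.tmul_mul_tmul, one_mul] at this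
    exact taylorSpan_mono (by omega) this
  | zero => simp
  | add a b _ _ ha hb => rw [TensorProduct.tmul_add]; exact add_mem ha hb
  | smul c a _ ha => rw [TensorProduct.tmul_smul]; exact Submodule.smul_mem _ _ ha

theorem varMonomial_mem_pow {B : Type*} [CommRing B] {J : Ideal B} {t : Fin r → B}
    (ht : ∀ i, t i ∈ J) (α : Fin r →₀ ℕ) : varMonomial t α ∈ J ^ α.degree := by
  rw [varMonomial, Finsupp.degree_eq_sum, ← Finset.prod_pow_eq_pow_sum]
  exact Ideal.prod_mem_prod fun i _ => Ideal.pow_mem_pow (ht i) _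

theorem tensorDiff_pow_mul_tmul_mem (hy : y ^ d ∈ degreeFiltration k x y d d)
    (m : ℕ) {N M : ℕ} {a b : A}
    (ha : a ∈ degreeFiltration k x y d N) (hb : b ∈ degreeFiltration k x y d M) :
    tensorDiff k y ^ m * (a ⊗ₜ[k] b) ∈ taylorSpan k x y d (N + M + 2 * m) := by
  induction m generalizing N M a b with
  | zero => simpa using tmul_mem_taylorSpan ha hb
  | succ m ih =>
    have e : tensorDiff k y ^ (m + 1) * (a ⊗ₜ[k] b) =
        tensorDiff k y ^ m * (a ⊗ₜ[k] (y * b)) - tensorDiff k y ^ m * ((y * a) ⊗ₜ[k] b) := by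
      have h1 : a ⊗ₜ[k] (y * b) = (1 ⊗ₜ[k] y) * (a ⊗ₜ[k] b) := by simp
      have h2 : (y * a) ⊗ₜ[k] b = (y ⊗ₜ[k] 1) * (a ⊗ₜ[k] b) := by simp
      rw [h1, h2, pow_succ]
      nth_rw 2 [tensorDiff]
      ring
    rw [e]
    exact sub_mem (taylorSpan_mono (by omega) (ih ha (y_mul_mem hy hb)))
      (taylorSpan_mono (by omega) (ih (y_mul_mem hy ha) hb))

/-- The span of the tensors of reduced monomials of bounded degree. -/
noncomputable abbrev baseTensor (k : Type*) {A : Type*} [Field k] [CommRing A] [Algebra k A] {r : ℕ}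
    (x : Fin r → A) (y : A) (d N M : ℕ) : Submodule k (A ⊗[k] A) :=
  LinearMap.range (TensorProduct.mapIncl (baseFiltration k x y d N) (baseFiltration k x y d M))

theorem finrank_baseTensor_source
    (hind : LinearIndependent k fun p : (Fin r →₀ ℕ) × Fin d =>
      varMonomial x p.1 * y ^ (p.2 : ℕ)) (N M : ℕ) :
    Module.finrank k (baseFiltration k x y d N ⊗[k] baseFiltration k x y d M) =
      monomialCount r N * d * (monomialCount r M * d) := by
  rw [Module.finrank_tensorProduct, finrank_baseFiltration hind, finrank_baseFiltration hind]

theorem tensorDiff_pow_mul_mem (hy : y ^ d ∈ degreeFiltration k x y d d)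
    (m : ℕ) {N M : ℕ} {h : A ⊗[k] A} (hh : h ∈ baseTensor k x y d N M) :
    tensorDiff k y ^ m * h ∈ taylorSpan k x y d (N + M + 2 * d + 2 * m) := by
  obtain ⟨h, rfl⟩ := hh
  induction h with
  | zero => simp
  | add a b ha hb => rw [map_add, mul_add]; exact add_mem ha hb
  | tmul a b =>
    rw [TensorProduct.mapIncl, TensorProduct.map_tmul]
    have := tensorDiff_pow_mul_tmul_mem hy m (baseFiltration_le_degreeFiltration _ a.2)
      (baseFiltration_le_degreeFiltration _ b.2)
    exact taylorSpan_mono (by omega) this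

/-- The truncated Taylor monomials `(x ^ β * y ^ j ⊗ 1) * δ ^ α * (1 ⊗ y ^ l)` modulo the
`L + 1`-st power of the ideal generated by the `δ i`. -/
noncomputable def taylorMonomial (k : Type*) {A : Type*} [Field k] [CommRing A] [Algebra k A]
    {r : ℕ} (x : Fin r → A) (y : A) (d N L : ℕ)
    (p : ({α : Fin r →₀ ℕ // α.degree ≤ N} × Fin d) ×
      ({α : Fin r →₀ ℕ // α.degree ≤ L} × Fin d)) :
    (A ⊗[k] A) ⧸ (tensorDiffIdeal k x ^ (L + 1)).restrictScalars k :=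
  Submodule.mkQ _ (((varMonomial x p.1.1 * y ^ (p.1.2 : ℕ)) ⊗ₜ[k] 1) *
    varMonomial (fun i => tensorDiff k (x i)) p.2.1 * (1 ⊗ₜ[k] (y ^ (p.2.2 : ℕ))))

theorem mkQ_mem_span_taylorMonomial {L N l : ℕ} (hl : l < d) (α : Fin r →₀ ℕ) {a : A}
    (ha : a ∈ baseFiltration k x y d N) :
    ((tensorDiffIdeal k x ^ (L + 1)).restrictScalars k).mkQ
      ((a ⊗ₜ[k] 1) * varMonomial (fun i => tensorDiff k (x i)) α * (1 ⊗ₜ[k] (y ^ l))) ∈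
      Submodule.span k (Set.range (taylorMonomial k x y d N L)) := by
  rcases Nat.lt_or_ge L α.degree with hα | hα
  · have : (a ⊗ₜ[k] 1) * varMonomial (fun i => tensorDiff k (x i)) α * (1 ⊗ₜ[k] (y ^ l)) ∈
        (tensorDiffIdeal k x ^ (L + 1)).restrictScalars k :=
      Ideal.mul_mem_right _ _ (Ideal.mul_mem_left _ _ (Ideal.pow_le_pow_right hα
        (varMonomial_mem_pow tensorDiff_mem α)))
    rw [Submodule.mkQ_apply, (Submodule.Quotient.mk_eq_zero _).2 this]
    exact zero_mem _
  · induction ha using Submodule.span_induction with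
    | zero => simp
    | add a b _ _ ha hb =>
      rw [TensorProduct.add_tmul, add_mul, add_mul, map_add]; exact add_mem ha hb
    | smul c a _ ha =>
      rw [← TensorProduct.smul_tmul', smul_mul_assoc, smul_mul_assoc, map_smul]
      exact Submodule.smul_mem _ _ ha
    | mem z h =>
      obtain ⟨p, rfl⟩ := h
      exact Submodule.subset_span ⟨(p, (⟨α, hα⟩, ⟨l, hl⟩)), rfl⟩

theorem mkQ_mem_span_of_mem_taylorSpan {L N : ℕ} {z : A ⊗[k] A}
    (hz : z ∈ taylorSpan k x y d N) :
    ((tensorDiffIdeal k x ^ (L + 1)).restrictScalars k).mkQ z ∈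
      Submodule.span k (Set.range (taylorMonomial k x y d N L)) := by
  induction hz using Submodule.span_induction with
  | zero => simp
  | add a b _ _ ha hb => rw [map_add]; exact add_mem ha hb
  | smul c a _ ha => rw [map_smul]; exact Submodule.smul_mem _ _ ha
  | mem z h =>
    obtain ⟨a, ha, α, l, hl, rfl⟩ := h
    exact mkQ_mem_span_taylorMonomial hl α (degreeFiltration_le_baseFiltration _ ha)

theorem exists_mul_pow_mem_pow (hd : 1 ≤ d) (hy : y ^ d ∈ degreeFiltration k x y d d)
    (hind : LinearIndependent k fun p : (Fin r →₀ ℕ) × Fin d =>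
      varMonomial x p.1 * y ^ (p.2 : ℕ)) {B K L : ℕ}
    (hcount : monomialCount r (B + K + 2 * d + 2 * (L + 1)) * d * (monomialCount r L * d) <
      monomialCount r B * d * (monomialCount r K * d) +
        monomialCount r L * (monomialCount r (B + K + 2 * d + 2 * (L + 1)) * d))
    (htaylor : ∀ c : {α : Fin r →₀ ℕ // α.degree ≤ L} → A,
      ∑ α, (c α ⊗ₜ[k] (1 : A)) * varMonomial (fun i => tensorDiff k (x i)) α ∈
        tensorDiffIdeal k x ^ (L + 1) ⊔ Ideal.span {tensorDiff k y ^ (L + 1)} → c = 0) :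
    ∃ h ∈ baseTensor k x y d B K, h ≠ 0 ∧
      tensorDiff k y ^ (L + 1) * h ∈ tensorDiffIdeal k x ^ (L + 1) := by
  set N := B + K + 2 * d + 2 * (L + 1) with hN
  let I := tensorDiffIdeal k x ^ (L + 1)
  let U := baseFiltration k x y d B ⊗[k] baseFiltration k x y d K
  let V := {α : Fin r →₀ ℕ // α.degree ≤ L} → baseFiltration k x y d N
  let ι : U →ₗ[k] A ⊗[k] A := TensorProduct.mapIncl _ _
  have hι : Function.Injective ι := TensorProduct.map_injective_of_flat_flat _ _
    (Submodule.subtype_injective _) (Submodule.subtype_injective _)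
  let f₁ : U →ₗ[k] A ⊗[k] A := LinearMap.mulLeft k (tensorDiff k y ^ (L + 1)) ∘ₗ ι
  let f₂ : V →ₗ[k] A ⊗[k] A := ∑ α, LinearMap.mulRight k (varMonomial (fun i =>
    tensorDiff k (x i)) α.1) ∘ₗ (TensorProduct.mk k A A).flip 1 ∘ₗ
      (baseFiltration k x y d N).subtype ∘ₗ LinearMap.proj α
  have hf₂ : ∀ v : V, f₂ v =
      ∑ α, ((v α : A) ⊗ₜ[k] (1 : A)) * varMonomial (fun i => tensorDiff k (x i)) α := by
    intro v
    simp [f₂]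
    rfl
  let f : U × V →ₗ[k] (A ⊗[k] A) ⧸ I.restrictScalars k :=
    (I.restrictScalars k).mkQ ∘ₗ (f₁.coprod (-f₂))
  have hfin : Module.finrank k (U × V) = monomialCount r B * d * (monomialCount r K * d) +
        monomialCount r L * (monomialCount r N * d) := by
    rw [Module.finrank_prod, finrank_baseTensor_source hind, Module.finrank_pi_fintype]
    simp [finrank_baseFiltration hind, card_degree_le]
  have hspan : ∀ z, f z ∈ Submodule.span k (Set.range (taylorMonomial k x y d N L)) := by
    intro z
    have e : f z = (I.restrictScalars k).mkQ (tensorDiff k y ^ (L + 1) * ι z.1) -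
        ∑ α, (I.restrictScalars k).mkQ (((z.2 α : A) ⊗ₜ[k] (1 : A)) *
          varMonomial (fun i => tensorDiff k (x i)) α * (1 ⊗ₜ[k] (y ^ 0))) := by
      simp only [pow_zero, ← Algebra.TensorProduct.one_def, mul_one, ← map_sum, ← map_sub, ← hf₂]
      simp [f, f₁, sub_eq_add_neg]
    rw [e]
    exact sub_mem (mkQ_mem_span_of_mem_taylorSpan (tensorDiff_pow_mul_mem hy _ ⟨z.1, rfl⟩))
      (sum_mem fun α _ => mkQ_mem_span_taylorMonomial hd _ (z.2 α).2)
  obtain ⟨⟨u, v⟩, hne, hz⟩ := LinearMap.exists_ne_zero_of_card_lt (k := k) (V := U × V)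
    (W := (A ⊗[k] A) ⧸ I.restrictScalars k) f _ hspan (by
    rw [hfin]; simpa [card_degree_le] using hcount)
  have hmem : tensorDiff k y ^ (L + 1) * ι u - f₂ v ∈ I := by
    have h1 : f (u, v) = (I.restrictScalars k).mkQ (tensorDiff k y ^ (L + 1) * ι u - f₂ v) := by
      simp [f, f₁, sub_eq_add_neg]
    rw [h1] at hz
    exact (Submodule.Quotient.mk_eq_zero _).1 hz
  have hv : (fun α => (v α : A)) = 0 := by
    apply htaylor
    rw [← hf₂]
    have : f₂ v = -(tensorDiff k y ^ (L + 1) * ι u - f₂ v) + tensorDiff k y ^ (L + 1) * ι u := by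
      ring
    rw [this]
    exact Submodule.add_mem_sup (neg_mem hmem)
      (Ideal.mul_mem_right _ _ (Ideal.mem_span_singleton_self _))
  have hv0 : v = 0 := by
    funext α
    exact Subtype.ext (congrFun hv α)
  subst hv0
  refine ⟨ι u, ⟨u, rfl⟩, ?_, by simpa using hmem⟩
  rw [Ne, map_eq_zero_iff ι hι]
  rintro rfl
  exact hne rfl

end Auxiliary

section Nonvanishing

variable {k A : Type*} [Field k] [CommRing A] [Algebra k A] {r : ℕ}
variable {x : Fin r → A} {y : A} {d : ℕ}

theorem tmul_mem_baseTensor {N M : ℕ} {a b : A} (ha : a ∈ baseFiltration k x y d N)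
    (hb : b ∈ baseFiltration k x y d M) : a ⊗ₜ[k] b ∈ baseTensor k x y d N M :=
  ⟨⟨a, ha⟩ ⊗ₜ ⟨b, hb⟩, by simp [TensorProduct.mapIncl]⟩

theorem baseTensor_mul_mem (hy : y ^ d ∈ degreeFiltration k x y d d) {N M N' M' : ℕ}
    {h g : A ⊗[k] A} (hh : h ∈ baseTensor k x y d N M) (hg : g ∈ baseTensor k x y d N' M') :
    h * g ∈ baseTensor k x y d (N + N' + 2 * d) (M + M' + 2 * d) := by
  obtain ⟨h, rfl⟩ := hh
  obtain ⟨g, rfl⟩ := hg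
  induction h with
  | zero => simp
  | add a b ha hb => rw [map_add, add_mul]; exact add_mem ha hb
  | tmul a b =>
    induction g with
    | zero => simp
    | add a b ha hb => rw [map_add, mul_add]; exact add_mem ha hb
    | tmul a' b' =>
      simp only [TensorProduct.mapIncl, TensorProduct.map_tmul, Submodule.subtype_apply,
        Algebra.TensorProduct.tmul_mul_tmul]
      exact tmul_mem_baseTensor (baseFiltration_mul_mem hy a.2 a'.2)
        (baseFiltration_mul_mem hy b.2 b'.2)

theorem baseTensor_mono {N M N' M' : ℕ} (hN : N ≤ N') (hM : M ≤ M') :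
    baseTensor k x y d N M ≤ baseTensor k x y d N' M' := by
  rintro _ ⟨h, rfl⟩
  induction h with
  | zero => simp
  | add a b ha hb => rw [map_add]; exact add_mem ha hb
  | tmul a b =>
    simp only [TensorProduct.mapIncl, TensorProduct.map_tmul, Submodule.subtype_apply]
    exact tmul_mem_baseTensor (baseFiltration_mono hN a.2) (baseFiltration_mono hM b.2)

theorem mem_span_of_mem_baseTensor {N M : ℕ} {h : A ⊗[k] A} (hh : h ∈ baseTensor k x y d N M) :
    h ∈ Submodule.span k (Set.range fun p : ({α : Fin r →₀ ℕ // α.degree ≤ N} × Fin d) ×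
      ({α : Fin r →₀ ℕ // α.degree ≤ M} × Fin d) =>
        (varMonomial x p.1.1 * y ^ (p.1.2 : ℕ)) ⊗ₜ[k] (varMonomial x p.2.1 * y ^ (p.2.2 : ℕ))) := by
  obtain ⟨h, rfl⟩ := hh
  induction h with
  | zero => simp
  | add a b ha hb => rw [map_add]; exact add_mem ha hb
  | tmul a b =>
    obtain ⟨a, ha⟩ := a
    obtain ⟨b, hb⟩ := b
    simp only [TensorProduct.mapIncl, TensorProduct.map_tmul, Submodule.subtype_apply]
    have := Submodule.apply_mem_map₂ (TensorProduct.mk k A A) ha hb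
    rw [baseFiltration, baseFiltration, Submodule.map₂_span_span] at this
    refine Submodule.span_mono ?_ this
    rintro _ ⟨_, ⟨p, rfl⟩, _, ⟨p', rfl⟩, rfl⟩
    exact ⟨(p, p'), rfl⟩

theorem varMonomial_mem_baseFiltration (hd : 1 ≤ d) {α : Fin r →₀ ℕ} {N : ℕ}
    (h : α.degree ≤ N) : varMonomial x α ∈ baseFiltration k x y d N :=
  Submodule.subset_span ⟨(⟨α, h⟩, ⟨0, hd⟩), by simp⟩

theorem linearIndependent_varMonomial (hd : 1 ≤ d)
    (hind : LinearIndependent k fun p : (Fin r →₀ ℕ) × Fin d =>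
      varMonomial x p.1 * y ^ (p.2 : ℕ)) : LinearIndependent k (varMonomial x) := by
  have := hind.comp (fun α : Fin r →₀ ℕ => (α, (⟨0, hd⟩ : Fin d))) (by
    intro a b h; simpa using h)
  simpa [Function.comp_def] using this

theorem map_ne_zero_of_mem_baseTensor (hd : 1 ≤ d) (hy : y ^ d ∈ degreeFiltration k x y d d)
    (hind : LinearIndependent k fun p : (Fin r →₀ ℕ) × Fin d =>
      varMonomial x p.1 * y ^ (p.2 : ℕ)) {B D q : ℕ}
    (hcount : (monomialCount r (D + B + 2 * d) * d) * (monomialCount r (D + B + 2 * d) * d) <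
      (monomialCount r D * d) * (monomialCount r D * d) +
        monomialCount r (D + B + 2 * d) * monomialCount r (D + B + 2 * d))
    (hq : D + B + 2 * d < q) {F : A →ₐ[k] A} {π : A ⊗[k] A →ₐ[k] A}
    (hπ : ∀ a b, π (a ⊗ₜ b) = a * F b) (hF : ∀ i, F (x i) = x i ^ q)
    {h : A ⊗[k] A} (hh : h ∈ baseTensor k x y d B B) (hreg : ∀ v, h * v = 0 → v = 0) :
    π h ≠ 0 := by
  intro h0
  set M := D + B + 2 * d with hM
  let U := baseFiltration k x y d D ⊗[k] baseFiltration k x y d D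
  let T := {α : Fin r →₀ ℕ // α.degree ≤ M}
  let V := T × T → k
  let ι : U →ₗ[k] A ⊗[k] A := TensorProduct.mapIncl _ _
  have hι : Function.Injective ι := TensorProduct.map_injective_of_flat_flat _ _
    (Submodule.subtype_injective _) (Submodule.subtype_injective _)
  let g : V →ₗ[k] A ⊗[k] A :=
    Fintype.linearCombination k fun p : T × T => varMonomial x p.1.1 ⊗ₜ[k] varMonomial x p.2.1
  have hg : ∀ w : V, g w = ∑ p : T × T, w p • varMonomial x p.1.1 ⊗ₜ[k] varMonomial x p.2.1 :=
    fun w => Fintype.linearCombination_apply _ _ _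
  let f : U × V →ₗ[k] A ⊗[k] A := (LinearMap.mulLeft k h ∘ₗ ι).coprod (-g)
  have hf : ∀ z : U × V, f z = h * ι z.1 - g z.2 := by
    intro z; simp [f, sub_eq_add_neg]
  have hfin : Module.finrank k (U × V) = (monomialCount r D * d) * (monomialCount r D * d) +
      monomialCount r M * monomialCount r M := by
    rw [Module.finrank_prod, finrank_baseTensor_source hind]
    simp [V, T, card_degree_le]
  obtain ⟨⟨v, w⟩, hne, hz⟩ := LinearMap.exists_ne_zero_of_card_lt (k := k) (V := U × V)
    (W := A ⊗[k] A) f _ (fun z => mem_span_of_mem_baseTensor (N := M) (M := M) (by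
      rw [hf, hg]
      refine sub_mem (baseTensor_mono (by omega) (by omega)
        (baseTensor_mul_mem hy hh ⟨z.1, rfl⟩)) (sum_mem fun p _ => Submodule.smul_mem _ _ ?_)
      exact tmul_mem_baseTensor (varMonomial_mem_baseFiltration hd p.1.2)
        (varMonomial_mem_baseFiltration hd p.2.2))) (by
    rw [hfin]; simpa [card_degree_le] using hcount)
  have hw : w = 0 := by
    have h1 := congrArg π hz
    rw [hf, map_sub, map_mul, h0, zero_mul, zero_sub, hg, map_zero, neg_eq_zero, map_sum] at h1
    have h2 : LinearIndependent k fun p : T × T => varMonomial x (p.1.1 + q • p.2.1) := by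
      refine (linearIndependent_varMonomial hd hind).comp
        (fun p : T × T => p.1.1 + q • p.2.1) ?_
      rintro ⟨⟨a, ha⟩, ⟨b, hb⟩⟩ ⟨⟨a', ha'⟩, ⟨b', hb'⟩⟩ h
      have hlt : ∀ c : Fin r →₀ ℕ, c.degree ≤ M → ∀ i, c i < q := fun c hc i =>
        ((Finsupp.le_degree i c).trans hc).trans_lt hq
      have key : ∀ i, a i = a' i ∧ b i = b' i := by
        intro i
        have h3 : a i + q * b i = a' i + q * b' i := by simpa using DFunLike.congr_fun h i
        have h4 := congrArg (· % q) h3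
        have h5 := congrArg (· / q) h3
        have hq0 : 0 < q := by omega
        simp only [Nat.add_mul_mod_self_left, Nat.mod_eq_of_lt (hlt a ha i),
          Nat.mod_eq_of_lt (hlt a' ha' i)] at h4
        simp only [Nat.add_mul_div_left _ _ hq0, Nat.div_eq_of_lt (hlt a ha i),
          Nat.div_eq_of_lt (hlt a' ha' i), zero_add] at h5
        exact ⟨h4, h5⟩
      have e1 : a = a' := Finsupp.ext fun i => (key i).1
      have e2 : b = b' := Finsupp.ext fun i => (key i).2
      subst e1 e2
      rfl
    rw [Fintype.linearIndependent_iff] at h2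
    funext p
    refine h2 w ?_ p
    rw [← h1]
    refine Finset.sum_congr rfl fun p _ => ?_
    rw [map_smul, hπ, varMonomial_map, varMonomial_add, ← varMonomial_pow]
    simp only [hF]
  subst hw
  have hv : ι v = 0 := by
    apply hreg
    rw [hf] at hz
    simpa using hz
  rw [map_eq_zero_iff ι hι] at hv
  subst hv
  exact hne rfl

end Nonvanishing

section Vanishing

open Polynomial in
/-- The coefficient of `X ^ n` in the remainder of a polynomial modulo a power of `X ^ q - X`
of degree larger than `n`. -/
noncomputable def remainderCoeff (k : Type*) [Field k] (q n : ℕ) : k[X] →ₗ[k] k :=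
  Polynomial.lcoeff k n ∘ₗ
    Polynomial.modByMonicHom ((Polynomial.X ^ q - Polynomial.X : k[X]) ^ (n / q + 1))

variable {k : Type*} [Field k]

theorem remainderCoeff_X_pow {q n a : ℕ} (hq : 2 ≤ q) (ha : a ≤ n) :
    remainderCoeff k q n ((Polynomial.X : Polynomial k) ^ a) = if a = n then 1 else 0 := by
  have hm : ((Polynomial.X : Polynomial k) ^ q - Polynomial.X).Monic :=
    Polynomial.monic_X_pow_sub (by rw [Polynomial.degree_X]; exact_mod_cast hq)
  have hdeg : ((Polynomial.X : Polynomial k) ^ q - Polynomial.X).natDegree = q :=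
    FiniteField.X_pow_card_sub_X_natDegree_eq k hq
  have h : ((Polynomial.X : Polynomial k) ^ a) %ₘ
      (Polynomial.X ^ q - Polynomial.X) ^ (n / q + 1) = Polynomial.X ^ a := by
    rw [Polynomial.modByMonic_eq_self_iff (hm.pow _), Polynomial.degree_X_pow,
      Polynomial.degree_eq_natDegree (hm.pow _).ne_zero, Polynomial.natDegree_pow, hdeg]
    have := Nat.lt_div_mul_add (a := n) (show 0 < q by omega)
    exact_mod_cast (show a < (n / q + 1) * q by rw [add_mul]; omega)
  simp [remainderCoeff, Polynomial.modByMonicHom, h, Polynomial.coeff_X_pow, eq_comm]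

theorem remainderCoeff_eq_zero {q n b : ℕ} (hq : 2 ≤ q) (hb : n / q + 1 ≤ b)
    (p : Polynomial k) :
    remainderCoeff k q n (p * (Polynomial.X ^ q - Polynomial.X) ^ b) = 0 := by
  have hm : ((Polynomial.X : Polynomial k) ^ q - Polynomial.X).Monic :=
    Polynomial.monic_X_pow_sub (by rw [Polynomial.degree_X]; exact_mod_cast hq)
  have h : (p * (Polynomial.X ^ q - Polynomial.X) ^ b) %ₘ
      (Polynomial.X ^ q - Polynomial.X) ^ (n / q + 1) = 0 :=
    (Polynomial.modByMonic_eq_zero_iff_dvd (hm.pow _)).2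
      (dvd_mul_of_dvd_right (pow_dvd_pow _ hb) _)
  simp [remainderCoeff, Polynomial.modByMonicHom, h]

theorem span_range_pow_le {A : Type*} [CommRing A] {r : ℕ} (t : Fin r → A) (m : ℕ) :
    Ideal.span (Set.range t) ^ m ≤
      Ideal.span {z | ∃ β : Fin r →₀ ℕ, β.degree = m ∧ z = varMonomial t β} := by
  induction m with
  | zero =>
    rw [pow_zero, Ideal.one_eq_top, top_le_iff, Ideal.eq_top_iff_one]
    exact Ideal.subset_span ⟨0, by simp, (varMonomial_zero t).symm⟩
  | succ m ih =>
    rw [pow_succ']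
    refine (Ideal.mul_mono_right ih).trans ?_
    rw [Ideal.span_mul_span']
    refine Ideal.span_mono ?_
    rintro _ ⟨_, ⟨i, rfl⟩, _, ⟨β, hβ, rfl⟩, rfl⟩
    exact ⟨Finsupp.single i 1 + β, by simp [hβ, add_comm], by
      simp [varMonomial_add, varMonomial_single]⟩

variable {A : Type*} [CommRing A] [Algebra k A] {r d : ℕ} {x : Fin r → A} {y : A}

/-- The product over the variables of the functionals `remainderCoeff`, on the part of degree `j`
in `y`. -/
noncomputable def remainderFunctional (b : Module.Basis ((Fin r →₀ ℕ) × Fin d) k A) (q : ℕ)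
    (γ : Fin r →₀ ℕ) (j : Fin d) : A →ₗ[k] k :=
  b.constr k fun p => if p.2 = j then
    ∏ i, remainderCoeff k q (γ i) ((Polynomial.X : Polynomial k) ^ p.1 i) else 0

theorem remainderFunctional_prod (b : Module.Basis ((Fin r →₀ ℕ) × Fin d) k A)
    (hb : ∀ p, b p = varMonomial x p.1 * y ^ (p.2 : ℕ)) (q : ℕ) (γ : Fin r →₀ ℕ) (j j' : Fin d)
    (p : Fin r → Polynomial k) :
    remainderFunctional b q γ j ((∏ i, Polynomial.aeval (x i) (p i)) * y ^ (j' : ℕ)) =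
      if j' = j then ∏ i, remainderCoeff k q (γ i) (p i) else 0 := by
  let φ : MultilinearMap k (fun _ : Fin r => Polynomial k) k :=
    (remainderFunctional b q γ j ∘ₗ LinearMap.mulRight k (y ^ (j' : ℕ))).compMultilinearMap
      ((MultilinearMap.mkPiAlgebra k (Fin r) A).compLinearMap
        fun i => (Polynomial.aeval (x i)).toLinearMap)
  let ψ : MultilinearMap k (fun _ : Fin r => Polynomial k) k :=
    (if j' = j then (1 : k) else 0) • (MultilinearMap.mkPiAlgebra k (Fin r) k).compLinearMap
      fun i => remainderCoeff k q (γ i)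
  have h : φ = ψ := by
    refine Module.Basis.ext_multilinear (fun _ => Polynomial.basisMonomials k) fun v => ?_
    have h1 : ∏ i, x i ^ v i = varMonomial x (Finsupp.equivFunOnFinite.symm v) := by
      simp [varMonomial]
    have h2 := b.constr_basis k (fun p => if p.2 = j then
      ∏ i, remainderCoeff k q (γ i) ((Polynomial.X : Polynomial k) ^ p.1 i) else 0)
      (Finsupp.equivFunOnFinite.symm v, j')
    rw [hb] at h2
    simp only [φ, ψ, LinearMap.compMultilinearMap_apply, MultilinearMap.compLinearMap_apply,
      MultilinearMap.mkPiAlgebra_apply, smul_apply, LinearMap.comp_apply,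
      LinearMap.mulRight_apply, AlgHom.toLinearMap_apply, Polynomial.coe_basisMonomials,
      Polynomial.monomial_one_right_eq_X_pow, map_pow, Polynomial.aeval_X, h1]
    rw [remainderFunctional, h2]
    simp
  have := congrArg (fun f => f p) h
  simp only [φ, ψ, LinearMap.compMultilinearMap_apply, MultilinearMap.compLinearMap_apply,
    MultilinearMap.mkPiAlgebra_apply, smul_apply, LinearMap.comp_apply,
    LinearMap.mulRight_apply, AlgHom.toLinearMap_apply] at this
  rw [this]
  simp

theorem remainderFunctional_eq_zero (b : Module.Basis ((Fin r →₀ ℕ) × Fin d) k A)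
    (hb : ∀ p, b p = varMonomial x p.1 * y ^ (p.2 : ℕ)) {q m : ℕ} (hq : 2 ≤ q)
    {γ : Fin r →₀ ℕ} (hγ : γ.degree < q * m) (j : Fin d) {z : A}
    (hz : z ∈ Ideal.span (Set.range fun i => x i ^ q - x i) ^ m) :
    remainderFunctional b q γ j z = 0 := by
  replace hz := span_range_pow_le _ _ hz
  suffices h : ∀ c, remainderFunctional b q γ j (c * z) = 0 by simpa using h 1
  induction hz using Submodule.span_induction with
  | zero => simp
  | add a b _ _ ha hb => intro c; rw [mul_add, map_add, ha, hb, add_zero]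
  | smul c' a _ ha => intro c; rw [smul_eq_mul, ← mul_assoc]; exact ha _
  | mem z h =>
    obtain ⟨β, rfl, rfl⟩ := h
    have hlt : ∃ i, γ i / q + 1 ≤ β i := by
      by_contra! hge
      refine absurd hγ (not_lt.2 ?_)
      rw [Finsupp.degree_eq_sum, Finsupp.degree_eq_sum, Finset.mul_sum]
      refine Finset.sum_le_sum fun i _ => ?_
      calc q * β i ≤ q * (γ i / q) := Nat.mul_le_mul_left _ (by have := hge i; omega)
        _ ≤ γ i := Nat.mul_div_le _ _
    obtain ⟨i, hi⟩ := hlt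
    have h : remainderFunctional b q γ j ∘ₗ
        LinearMap.mulRight k (varMonomial (fun i => x i ^ q - x i) β) = 0 := by
      refine b.ext fun p => ?_
      have e : b p * varMonomial (fun i => x i ^ q - x i) β =
          (∏ i, Polynomial.aeval (x i) ((Polynomial.X : Polynomial k) ^ p.1 i *
            (Polynomial.X ^ q - Polynomial.X) ^ β i)) * y ^ (p.2 : ℕ) := by
        rw [hb]
        simp only [map_mul, map_pow, map_sub, Polynomial.aeval_X, Finset.prod_mul_distrib,
          varMonomial]
        ring
      rw [LinearMap.comp_apply, LinearMap.mulRight_apply, e, remainderFunctional_prod b hb,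
        Finset.prod_eq_zero (Finset.mem_univ i) (remainderCoeff_eq_zero hq hi _)]
      simp
    exact fun c => LinearMap.congr_fun h c

theorem eq_zero_of_mem_span_pow (b : Module.Basis ((Fin r →₀ ℕ) × Fin d) k A)
    (hb : ∀ p, b p = varMonomial x p.1 * y ^ (p.2 : ℕ)) {q m N : ℕ} (hq : 2 ≤ q)
    (hN : N < q * m) {z : A} (hzN : z ∈ degreeFiltration k x y d N)
    (hz : z ∈ Ideal.span (Set.range fun i => x i ^ q - x i) ^ m) : z = 0 := by
  by_contra hz0
  have hne : (b.repr z).support.Nonempty := by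
    rw [Finsupp.support_nonempty_iff]
    simpa using hz0
  have hsupp : ∀ p ∈ (b.repr z).support, p.1.degree ≤ N := by
    intro p hp
    by_contra hlt
    refine Finsupp.mem_support_iff.1 hp ?_
    clear hz hz0 hne hp
    induction hzN using Submodule.span_induction with
    | zero => simp
    | add a b _ _ ha hb => rw [map_add, Finsupp.add_apply, ha, hb, add_zero]
    | smul c a _ ha => rw [map_smul, Finsupp.smul_apply, ha, smul_zero]
    | mem z h =>
      obtain ⟨α, j, hj, hN', rfl⟩ := h
      have : varMonomial x α * y ^ j = b (α, ⟨j, hj⟩) := (hb (α, ⟨j, hj⟩)).symm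
      rw [this, b.repr_self, Finsupp.single_apply_eq_zero]
      rintro rfl
      exact absurd (show α.degree ≤ N by omega) hlt
  obtain ⟨⟨γ, j⟩, hγ, hmax⟩ := Finset.exists_max_image (b.repr z).support
    (fun p => p.1.degree) hne
  have h1 := remainderFunctional_eq_zero b hb hq ((hsupp _ hγ).trans_lt hN) j hz
  refine Finsupp.mem_support_iff.1 hγ ?_
  rw [remainderFunctional, Module.Basis.constr_apply, Finsupp.sum,
    Finset.sum_eq_single_of_mem _ hγ] at h1
  · simpa only [remainderCoeff_X_pow hq le_rfl, if_true, Finset.prod_const_one, smul_eq_mul,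
      mul_one] using h1
  · rintro ⟨α, j'⟩ hα hne'
    by_cases hj : j' = j
    · subst hj
      have hlt : ∃ i, α i < γ i := by
        by_contra! hge
        have hle : γ ≤ α := hge
        obtain ⟨c, rfl⟩ := exists_add_of_le hle
        have := hmax _ hα
        simp only [map_add] at this
        have hc : c.degree = 0 := by omega
        rw [Finsupp.degree_eq_zero_iff] at hc
        subst hc
        simp at hne'
      obtain ⟨i, hi⟩ := hlt
      rw [if_pos rfl, Finset.prod_eq_zero (Finset.mem_univ i), smul_zero]
      rw [remainderCoeff_X_pow hq hi.le, if_neg hi.ne]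
    · simp [hj]

end Vanishing

section Taylor

variable {k : Type*} [Field k] {r : ℕ} {f : Polynomial (MvPolynomial (Fin r) k)}

theorem AdjoinRoot.exists_nilpotent_lift {C : Type*} [CommRing C] [Algebra k C]
    (φ : AdjoinRoot f →ₐ[k] C) (hφ : IsUnit (φ (AdjoinRoot.mk f (Polynomial.derivative f))))
    {s : Fin r → C} (hs : ∀ i, IsNilpotent (s i)) :
    ∃ ψ : AdjoinRoot f →ₐ[k] C,
      (∀ i, ψ (AdjoinRoot.of f (X i)) = φ (AdjoinRoot.of f (X i)) + s i) ∧
      IsNilpotent (ψ (AdjoinRoot.root f) - φ (AdjoinRoot.root f)) := by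
  let τ : MvPolynomial (Fin r) k →ₐ[k] C := aeval fun i => φ (AdjoinRoot.of f (X i)) + s i
  let π := Ideal.Quotient.mk (nilradical C)
  have hτ : π.comp (τ : _ →+* C) = (π.comp (φ : _ →+* C)).comp (AdjoinRoot.of f) := by
    refine MvPolynomial.ringHom_ext (fun c => ?_) fun i => ?_
    · have h1 : AdjoinRoot.of f (MvPolynomial.C c) = algebraMap k _ c := rfl
      simp [τ, h1]
    · have : Ideal.Quotient.mk (nilradical C) (s i) = 0 :=
        Ideal.Quotient.eq_zero_iff_mem.2 (hs i)
      simp [τ, π, this]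
  have key : ∀ P : Polynomial (MvPolynomial (Fin r) k),
      IsNilpotent (P.eval₂ (τ : _ →+* C) (φ (AdjoinRoot.root f)) - φ (AdjoinRoot.mk f P)) := by
    intro P
    have h2 : AdjoinRoot.mk f P = P.eval₂ (AdjoinRoot.of f) (AdjoinRoot.root f) := by
      rw [← AdjoinRoot.aeval_eq]; rfl
    rw [← mem_nilradical, ← Ideal.Quotient.eq, h2]
    have h3 := Polynomial.hom_eval₂ P (AdjoinRoot.of f) (φ : _ →+* C) (AdjoinRoot.root f)
    simp only [RingHom.coe_coe] at h3
    rw [h3, Polynomial.hom_eval₂, Polynomial.hom_eval₂, hτ]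
    rfl
  let g : Polynomial C := f.map (τ : _ →+* C)
  have hg : ∀ z, Polynomial.aeval z g = f.eval₂ (τ : _ →+* C) z := by
    intro z
    rw [Polynomial.coe_aeval_eq_eval, Polynomial.eval_map]
  have hg0 : IsNilpotent (Polynomial.aeval (φ (AdjoinRoot.root f)) g) := by
    have := key f
    rwa [AdjoinRoot.mk_self, map_zero, sub_zero, ← hg] at this
  have hg1 : IsUnit (Polynomial.aeval (φ (AdjoinRoot.root f)) (Polynomial.derivative g)) := by
    have h1 := key (Polynomial.derivative f)
    rw [Polynomial.derivative_map, Polynomial.coe_aeval_eq_eval, Polynomial.eval_map]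
    have := h1.isUnit_add_left_of_commute hφ (Commute.all _ _)
    simpa using this
  obtain ⟨η, ⟨h1, h2⟩, -⟩ := Polynomial.existsUnique_nilpotent_sub_and_aeval_eq_zero hg0 hg1
  rw [hg] at h2
  refine ⟨AdjoinRoot.liftAlgHom f τ η h2, fun i => ?_, ?_⟩
  · rw [AdjoinRoot.liftAlgHom_of]
    simp [τ]
  · rw [AdjoinRoot.liftAlgHom_root, ← neg_sub, isNilpotent_neg_iff]
    exact h1

theorem taylor_coefficients_eq_zero_of_surjective {L C : Type*} [Field L] [CommRing C]
    [Algebra k L] [Algebra k C] (ι : AdjoinRoot f →ₐ[k] L) (hι : Function.Injective ι)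
    (hder : AdjoinRoot.mk f (Polynomial.derivative f) ≠ 0) {n : ℕ}
    (π : MvPolynomial (Fin r) L →ₐ[k] C) (hπ : Function.Surjective π)
    (hπ0 : ∀ P, π P = 0 ↔ P ∈ idealOfVars (Fin r) L ^ (n + 1))
    (c : {α : Fin r →₀ ℕ // α.degree ≤ n} → AdjoinRoot f)
    (hc : ∑ α, (c α ⊗ₜ[k] (1 : AdjoinRoot f)) *
        varMonomial (fun i => tensorDiff k (AdjoinRoot.of f (X i))) α ∈
      tensorDiffIdeal k (fun i => AdjoinRoot.of f (X i)) ^ (n + 1) ⊔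
        Ideal.span {tensorDiff k (AdjoinRoot.root f) ^ (n + 1)}) : c = 0 := by
  let A := AdjoinRoot f
  let J := idealOfVars (Fin r) L
  let σ : L →ₐ[k] MvPolynomial (Fin r) L := IsScalarTower.toAlgHom k L _
  let φ : A →ₐ[k] C := (π.comp σ).comp ι
  have hφ : IsUnit (φ (AdjoinRoot.mk f (Polynomial.derivative f))) := by
    have : IsUnit (ι (AdjoinRoot.mk f (Polynomial.derivative f))) := by
      rw [isUnit_iff_ne_zero, Ne, map_eq_zero_iff ι hι]
      exact hder
    exact this.map (π.comp σ)
  have hX : ∀ i, (X i : MvPolynomial (Fin r) L) ∈ J := fun i =>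
    Ideal.subset_span (Set.mem_range_self i)
  obtain ⟨ψ, hψ, hψy⟩ := AdjoinRoot.exists_nilpotent_lift φ hφ (s := fun i => π (X i))
    (fun i => ⟨n + 1, by
      rw [← map_pow, hπ0]; exact Ideal.pow_mem_pow (hX i) _⟩)
  let Ψ : A ⊗[k] A →ₐ[k] C := Algebra.TensorProduct.lift φ ψ fun _ _ => mul_comm _ _
  have hΨ : ∀ a b, Ψ (a ⊗ₜ b) = φ a * ψ b := fun a b => Algebra.TensorProduct.lift_tmul _ _ _ _ _
  have hδ : ∀ i, Ψ (tensorDiff k (AdjoinRoot.of f (X i))) = π (X i) := by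
    intro i
    simp [tensorDiff, hΨ, hψ]
  have hω : Ψ (tensorDiff k (AdjoinRoot.root f)) ^ (n + 1) = 0 := by
    have h1 : Ψ (tensorDiff k (AdjoinRoot.root f)) =
        ψ (AdjoinRoot.root f) - φ (AdjoinRoot.root f) := by simp [tensorDiff, hΨ]
    rw [h1]
    obtain ⟨P, hP⟩ := hπ (ψ (AdjoinRoot.root f) - φ (AdjoinRoot.root f))
    obtain ⟨N, hN⟩ := hψy
    have hmem : ∀ Q : MvPolynomial (Fin r) L, Q ∈ J ↔ constantCoeff Q = 0 := by
      intro Q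
      have := mem_pow_idealOfVars_iff' (σ := Fin r) (R := L) 1 Q
      rw [pow_one] at this
      rw [this, constantCoeff_eq]
      constructor
      · intro h; exact h 0 (by simp)
      · intro h x hx
        have : x = 0 := by
          rw [← Finsupp.degree_eq_zero_iff]; omega
        rw [this]; exact h
    have h2 : P ∈ J := by
      rw [← hP, ← map_pow] at hN
      have := Ideal.pow_le_self (Nat.succ_ne_zero n) ((hπ0 _).1 hN)
      rw [hmem, map_pow] at this
      rw [hmem]
      exact eq_zero_of_pow_eq_zero this
    rw [← hP, ← map_pow]
    exact (hπ0 _).2 (Ideal.pow_mem_pow h2 _)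
  have hI : tensorDiffIdeal k (fun i => AdjoinRoot.of f (X i)) ≤ Ideal.comap Ψ (J.map π) := by
    refine Ideal.span_le.2 ?_
    rintro _ ⟨i, rfl⟩
    rw [SetLike.mem_coe, Ideal.mem_comap, hδ]
    exact Ideal.mem_map_of_mem _ (hX i)
  have hbot : J.map π ^ (n + 1) = ⊥ := by
    rw [← Ideal.map_pow]
    rw [eq_bot_iff, Ideal.map_le_iff_le_comap]
    exact fun P hP => (hπ0 P).2 hP
  have hker : tensorDiffIdeal k (fun i => AdjoinRoot.of f (X i)) ^ (n + 1) ⊔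
        Ideal.span {tensorDiff k (AdjoinRoot.root f) ^ (n + 1)} ≤ Ideal.comap Ψ ⊥ := by
    refine sup_le ?_ ?_
    · rw [← hbot]
      exact (Ideal.pow_right_mono hI _).trans (Ideal.le_comap_pow _ _)
    · rw [Ideal.span_le, Set.singleton_subset_iff, SetLike.mem_coe, Ideal.mem_comap, map_pow, hω]
      exact zero_mem _
  have h0 : Ψ (∑ α, (c α ⊗ₜ[k] (1 : AdjoinRoot f)) *
        varMonomial (fun i => tensorDiff k (AdjoinRoot.of f (X i))) α) = 0 := hker hc
  have h1 : π (∑ α, monomial α.1 (ι (c α))) = 0 := by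
    rw [← h0, map_sum, map_sum]
    refine Finset.sum_congr rfl fun α _ => ?_
    rw [map_mul, hΨ, map_one, mul_one, varMonomial_map]
    simp only [hδ]
    rw [← varMonomial_map, monomial_eq, map_mul]
    congr 2
    rw [varMonomial, Finsupp.prod_fintype _ _ (by simp)]
  rw [hπ0, mem_pow_idealOfVars_iff'] at h1
  funext α
  have h2 := h1 α.1 (by have := α.2; omega)
  rw [coeff_sum, Finset.sum_eq_single α] at h2
  · rw [coeff_monomial, if_pos rfl, map_eq_zero_iff ι hι] at h2
    exact h2
  · intro β _ hβ
    rw [coeff_monomial, if_neg (fun h => hβ (Subtype.ext h))]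
  · simp

theorem taylor_coefficients_eq_zero [IsDomain (AdjoinRoot f)]
    (hder : AdjoinRoot.mk f (Polynomial.derivative f) ≠ 0) {n : ℕ}
    (c : {α : Fin r →₀ ℕ // α.degree ≤ n} → AdjoinRoot f)
    (hc : ∑ α, (c α ⊗ₜ[k] (1 : AdjoinRoot f)) *
        varMonomial (fun i => tensorDiff k (AdjoinRoot.of f (X i))) α ∈
      tensorDiffIdeal k (fun i => AdjoinRoot.of f (X i)) ^ (n + 1) ⊔
        Ideal.span {tensorDiff k (AdjoinRoot.root f) ^ (n + 1)}) : c = 0 := by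
  let J := idealOfVars (Fin r) (FractionRing (AdjoinRoot f)) ^ (n + 1)
  let π : MvPolynomial (Fin r) (FractionRing (AdjoinRoot f)) →ₐ[k]
      MvPolynomial (Fin r) (FractionRing (AdjoinRoot f)) ⧸ J := Ideal.Quotient.mkₐ k J
  refine taylor_coefficients_eq_zero_of_surjective (L := FractionRing (AdjoinRoot f))
    (C := MvPolynomial (Fin r) (FractionRing (AdjoinRoot f)) ⧸ J)
    (IsScalarTower.toAlgHom k (AdjoinRoot f) (FractionRing (AdjoinRoot f)))
    (IsFractionRing.injective _ _) hder π (Ideal.Quotient.mkₐ_surjective _ _)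
    (fun P => Ideal.Quotient.eq_zero_iff_mem (I := J)) c hc

end Taylor

section TensorDomain

variable {k A B : Type*} [Field k] [IsAlgClosed k] [CommRing A] [Algebra k A]

theorem exists_algHom_ne_zero [IsDomain A] [Algebra.FiniteType k A] {a : A} (ha : a ≠ 0) :
    ∃ ρ : A →ₐ[k] k, ρ a ≠ 0 := by
  have hJ : IsJacobsonRing A := isJacobsonRing_of_finiteType (A := k)
  have h : a ∉ (⊥ : Ideal A).jacobson := by
    rw [hJ.out Ideal.isPrime_bot.isRadical]
    simpa using ha
  rw [Ideal.jacobson, Ideal.mem_sInf] at h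
  push Not at h
  obtain ⟨m, ⟨-, hm⟩, ham⟩ := h
  have : Algebra.FiniteType k (A ⧸ m) := inferInstance
  let : Field (A ⧸ m) := Ideal.Quotient.field m
  have hfin : Module.Finite k (A ⧸ m) := finite_of_finite_type_of_isJacobsonRing k (A ⧸ m)
  let e : k ≃ₐ[k] A ⧸ m := AlgEquiv.ofBijective (Algebra.ofId k (A ⧸ m))
    IsAlgClosed.algebraMap_bijective_of_isIntegral
  refine ⟨(e.symm : (A ⧸ m) →ₐ[k] k).comp (Ideal.Quotient.mkₐ k m), ?_⟩
  simpa [Ideal.Quotient.eq_zero_iff_mem] using ham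

theorem tensorProduct_mul_ne_zero [IsDomain A] [Algebra.FiniteType k A] [CommRing B] [IsDomain B]
    [Algebra k B] {u v : A ⊗[k] B} (hu : u ≠ 0) (hv : v ≠ 0) : u * v ≠ 0 := by
  intro huv
  let b := Module.Basis.ofVectorSpace k B
  let c := Algebra.TensorProduct.basis A b
  have hc : ∀ w : A ⊗[k] B, w ≠ 0 → ∃ i, c.repr w i ≠ 0 := by
    intro w hw
    by_contra! h
    exact hw (c.repr.map_eq_zero_iff.1 (Finsupp.ext h))
  obtain ⟨i, hi⟩ := hc u hu
  obtain ⟨j, hj⟩ := hc v hv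
  obtain ⟨ρ, hρ⟩ := exists_algHom_ne_zero (k := k) (mul_ne_zero hi hj)
  rw [map_mul] at hρ
  let φ : A ⊗[k] B →ₐ[k] B := Algebra.TensorProduct.lift ((Algebra.ofId k B).comp ρ)
    (AlgHom.id k B) fun _ _ => Commute.all _ _
  have hφ : ∀ w i, b.repr (φ w) i = ρ (c.repr w i) := by
    intro w i
    induction w with
    | zero => simp
    | add x y hx hy => simp [hx, hy]
    | tmul x y =>
      have : φ (x ⊗ₜ y) = ρ x • y := by
        simp [φ, Algebra.ofId_apply, Algebra.smul_def]
      rw [this]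
      simp [c, Algebra.TensorProduct.basis_repr_tmul]
  have hu' : φ u ≠ 0 := fun h => left_ne_zero_of_mul hρ (by rw [← hφ, h]; simp)
  have hv' : φ v ≠ 0 := fun h => right_ne_zero_of_mul hρ (by rw [← hφ, h]; simp)
  exact mul_ne_zero hu' hv' (by rw [← map_mul, huv, map_zero])

end TensorDomain

section Core

theorem map_mem_degreeFiltration {k A : Type*} [Field k] [CommRing A] [Algebra k A] {r d : ℕ}
    {x : Fin r → A} {y : A} (hd : 1 ≤ d) (hy : y ^ d ∈ degreeFiltration k x y d d) {q : ℕ}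
    {F : A →ₐ[k] A} (hFx : ∀ i, F (x i) = x i ^ q) (hFy : F y = y ^ q) {N : ℕ} {b : A}
    (hb : b ∈ degreeFiltration k x y d N) : F b ∈ degreeFiltration k x y d (q * N) := by
  induction hb using Submodule.span_induction with
  | zero => simp
  | add a b _ _ ha hb => rw [map_add]; exact add_mem ha hb
  | smul c a _ ha => rw [map_smul]; exact Submodule.smul_mem _ _ ha
  | mem z h =>
    obtain ⟨α, j, hj, hN, rfl⟩ := h
    have : F (varMonomial x α * y ^ j) = (varMonomial x α * y ^ j) ^ q := by
      rw [map_mul, varMonomial_map, map_pow, hFy]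
      simp only [hFx, mul_pow]
      rw [← pow_mul, ← pow_mul, mul_comm q j, varMonomial, varMonomial, ← Finset.prod_pow]
      simp_rw [← pow_mul, mul_comm q]
    rw [this]
    exact pow_mem_degreeFiltration hd hy (monomial_mem_degreeFiltration hj hN) q

variable {k : Type*} [Field k] {r : ℕ} {f : Polynomial (MvPolynomial (Fin r) k)}

theorem AdjoinRoot.exists_basis_varMonomial {d : ℕ} (hf : f.Monic) (hfd : f.natDegree = d) :
    ∃ b : Module.Basis ((Fin r →₀ ℕ) × Fin d) k (AdjoinRoot f), ∀ p,
      b p = varMonomial (fun i => AdjoinRoot.of f (X i)) p.1 *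
        AdjoinRoot.root f ^ (p.2 : ℕ) := by
  have hdim : (AdjoinRoot.powerBasis' hf).dim = d := by
    rw [AdjoinRoot.powerBasis'_dim, hfd]
  refine ⟨((MvPolynomial.basisMonomials (Fin r) k).smulTower
    (AdjoinRoot.powerBasis' hf).basis).reindex
      (Equiv.prodCongr (Equiv.refl _) (finCongr hdim)), fun p => ?_⟩
  rw [Module.Basis.reindex_apply, Module.Basis.smulTower_apply]
  simp only [PowerBasis.coe_basis, AdjoinRoot.powerBasis'_gen, coe_basisMonomials,
    Equiv.prodCongr_symm, Equiv.prodCongr_apply, Prod.map_fst, Prod.map_snd, Equiv.refl_symm,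
    Equiv.refl_apply, finCongr_symm, finCongr_apply, Fin.val_cast]
  rw [Algebra.smul_def, AdjoinRoot.algebraMap_eq, ← varMonomial_map, monomial_eq, C_1, one_mul,
    varMonomial, Finsupp.prod_fintype _ _ (by simp)]

theorem AdjoinRoot.of_eq_aeval (p : MvPolynomial (Fin r) k) :
    AdjoinRoot.of f p = aeval (fun i => AdjoinRoot.of f (X i)) p := by
  have : AdjoinRoot.ofAlgHom k f = aeval fun i => AdjoinRoot.of f (X i) := by
    refine MvPolynomial.algHom_ext fun i => ?_
    simp
  exact DFunLike.congr_fun this p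

theorem AdjoinRoot.root_pow_mem_degreeFiltration {d : ℕ} (hf : f.Monic)
    (hfd : f.natDegree = d) (hcoeff : ∀ i ≤ d, (f.coeff i).totalDegree + i ≤ d) :
    AdjoinRoot.root f ^ d ∈ degreeFiltration k (fun i => AdjoinRoot.of f (X i))
      (AdjoinRoot.root f) d d := by
  have h1 : AdjoinRoot.root f ^ d = -∑ i ∈ Finset.range d,
      AdjoinRoot.of f (f.coeff i) * AdjoinRoot.root f ^ i := by
    have h2 := AdjoinRoot.eval₂_root f
    rw [Polynomial.eval₂_eq_sum_range, hfd, Finset.sum_range_succ, ← hfd, hf.coeff_natDegree,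
      map_one, one_mul] at h2
    rw [← hfd]
    exact eq_neg_of_add_eq_zero_right h2
  rw [h1]
  refine neg_mem (sum_mem fun i hi => ?_)
  rw [Finset.mem_range] at hi
  rw [AdjoinRoot.of_eq_aeval, aeval_def, eval₂_eq', Finset.sum_mul]
  refine sum_mem fun α hα => ?_
  rw [mul_assoc, ← Algebra.smul_def]
  refine Submodule.smul_mem _ _ ?_
  refine monomial_mem_degreeFiltration (α := α) hi ?_
  exact (Nat.add_le_add_right (le_totalDegree hα) i).trans (hcoeff i hi.le)

theorem AdjoinRoot.finiteType_field : Algebra.FiniteType k (AdjoinRoot f) :=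
  .of_surjective (Ideal.Quotient.mkₐ k (Ideal.span {f})) (Ideal.Quotient.mkₐ_surjective _ _)

theorem exists_bound_forall_eq_zero (r d e : ℕ) (hd : 1 ≤ d) : ∃ N : ℕ,
    ∀ (k : Type) [Field k] [IsAlgClosed k] (f : Polynomial (MvPolynomial (Fin r) k)),
      f.Monic → f.natDegree = d → (∀ i ≤ d, (f.coeff i).totalDegree + i ≤ d) →
      Polynomial.derivative f ≠ 0 → Irreducible f → ∀ q, N < q →
      ∀ F : AdjoinRoot f →ₐ[k] AdjoinRoot f,
      (∀ i, F (AdjoinRoot.of f (X i)) = AdjoinRoot.of f (X i) ^ q) →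
      F (AdjoinRoot.root f) = AdjoinRoot.root f ^ q →
      ∀ z ∈ degreeFiltration k (fun i => AdjoinRoot.of f (X i)) (AdjoinRoot.root f) d e,
      z ∈ Ideal.span {AdjoinRoot.root f ^ q - AdjoinRoot.root f} ⊔
        Ideal.span (Set.range fun i => AdjoinRoot.of f (X i) ^ q - AdjoinRoot.of f (X i)) →
      z = 0 := by
  obtain ⟨K, B, D, hKB, hcount1, hcount2⟩ := exists_degree_parameters r d hd
  set m := K + d + 1 with hm
  refine ⟨(m + m) * e + B + 2 * d + D + 1, ?_⟩
  intro k _ _ f hf hfd hcoeff hder hirr q hq F hFx hFy z hz hzmem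
  set x := fun i => AdjoinRoot.of f (X i) with hx
  set y := AdjoinRoot.root f with hydef
  have hdom : IsDomain (AdjoinRoot f) := AdjoinRoot.isDomain_of_prime hirr.prime
  have hft : Algebra.FiniteType k (AdjoinRoot f) := AdjoinRoot.finiteType_field
  obtain ⟨b, hb⟩ := AdjoinRoot.exists_basis_varMonomial hf hfd
  have hind : LinearIndependent k fun p : (Fin r →₀ ℕ) × Fin d =>
      varMonomial x p.1 * y ^ (p.2 : ℕ) := by
    have := b.linearIndependent
    rwa [funext hb] at this
  have hy : y ^ d ∈ degreeFiltration k x y d d :=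
    AdjoinRoot.root_pow_mem_degreeFiltration hf hfd hcoeff
  have hder' : AdjoinRoot.mk f (Polynomial.derivative f) ≠ 0 := by
    rw [Ne, AdjoinRoot.mk_eq_zero]
    exact hf.not_dvd_of_degree_lt hder (Polynomial.degree_derivative_lt hf.ne_zero)
  obtain ⟨h, hh, hh0, hhI⟩ := exists_mul_pow_mem_pow hd hy hind (L := K + d) hcount1
    (fun c hc => taylor_coefficients_eq_zero hder' c hc)
  let π : AdjoinRoot f ⊗[k] AdjoinRoot f →ₐ[k] AdjoinRoot f :=
    Algebra.TensorProduct.lift (AlgHom.id k _) F fun _ _ => Commute.all _ _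
  have hπ : ∀ a b, π (a ⊗ₜ b) = a * F b := fun a b => by simp [π]
  have hπδ : ∀ a, π (tensorDiff k a) = F a - a := fun a => by simp [tensorDiff, hπ]
  have hπh : π h ≠ 0 := map_ne_zero_of_mem_baseTensor hd hy hind hcount2 (by omega) hπ hFx
    (baseTensor_mono le_rfl hKB hh) (fun v hv => by
      by_contra hv0
      exact tensorProduct_mul_ne_zero hh0 hv0 hv)
  set a := Ideal.span (Set.range fun i => x i ^ q - x i) with ha
  have hπI : tensorDiffIdeal k x ≤ Ideal.comap π a := by
    refine Ideal.span_le.2 ?_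
    rintro _ ⟨i, rfl⟩
    rw [SetLike.mem_coe, Ideal.mem_comap, hπδ, hFx]
    exact Ideal.subset_span (Set.mem_range_self i)
  have h1 : (y ^ q - y) ^ m * π h ∈ a ^ m := by
    have h2 : π (tensorDiff k y ^ m * h) ∈ a ^ m :=
      ((Ideal.pow_right_mono hπI m).trans (Ideal.le_comap_pow _ _)) hhI
    rwa [map_mul, map_pow, hπδ, hFy] at h2
  have h3 : z ^ (m + m) * π h ∈ a ^ m := by
    have h4 := Ideal.sup_pow_add_le_pow_sup_pow (Ideal.pow_mem_pow hzmem (m + m))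
    rw [Ideal.span_singleton_pow, Submodule.mem_sup] at h4
    obtain ⟨u, hu, v, hv, huv⟩ := h4
    obtain ⟨c, rfl⟩ := Ideal.mem_span_singleton'.1 hu
    rw [← huv, add_mul, mul_assoc]
    exact add_mem (Ideal.mul_mem_left _ _ h1) (Ideal.mul_mem_right _ _ hv)
  have h5 : π h ∈ degreeFiltration k x y d (B + d + q * (K + d)) := by
    obtain ⟨h, rfl⟩ := hh
    clear hh0 hhI hπh h1 h3
    induction h with
    | zero => simp
    | add a b ha hb => rw [map_add, map_add]; exact add_mem ha hb
    | tmul a b =>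
      rw [TensorProduct.mapIncl, TensorProduct.map_tmul, hπ]
      exact mul_mem_degreeFiltration hy (baseFiltration_le_degreeFiltration _ a.2)
        (map_mem_degreeFiltration hd hy hFx hFy (baseFiltration_le_degreeFiltration _ b.2))
  have h6 := mul_mem_degreeFiltration hy (pow_mem_degreeFiltration hd hy hz (m + m)) h5
  have h7 := eq_zero_of_mem_span_pow b hb (m := m) (q := q) (by omega) (by
    have : q * m = q * (K + d) + q := by rw [hm]; ring
    omega) h6 h3
  have h8 := (mul_eq_zero.1 h7).resolve_right hπh
  exact eq_zero_of_pow_eq_zero h8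

end Core

section FinitePoints

theorem MvPolynomial.totalDegree_map_le {R S σ : Type*} [CommSemiring R] [CommSemiring S]
    (φ : R →+* S) (p : MvPolynomial σ R) : (map φ p).totalDegree ≤ p.totalDegree :=
  Finset.sup_mono (support_map_subset φ p)

theorem FiniteField.prod_X_sub_C (K : Type*) [Field K] [Fintype K] :
    ∏ s : K, (Polynomial.X - Polynomial.C s) =
      Polynomial.X ^ Fintype.card K - (Polynomial.X : Polynomial K) := by
  have h := Polynomial.prod_multiset_X_sub_C_of_monic_of_roots_card_eq
    (p := (Polynomial.X ^ Fintype.card K - Polynomial.X : Polynomial K))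
    (by
      refine Polynomial.monic_X_pow_sub ?_
      rw [Polynomial.degree_X]
      exact_mod_cast Fintype.one_lt_card)
    (by
      rw [FiniteField.roots_X_pow_card_sub_X,
        FiniteField.X_pow_card_sub_X_natDegree_eq K Fintype.one_lt_card]
      simp)
  rwa [FiniteField.roots_X_pow_card_sub_X] at h

theorem MvPolynomial.mem_span_of_forall_eval_eq_zero {K σ : Type*} [Field K] [Fintype K] [Finite σ]
    {p : MvPolynomial σ K} (hp : ∀ x, eval x p = 0) :
    p ∈ Ideal.span (Set.range fun i => (X i ^ Fintype.card K - X i : MvPolynomial σ K)) := by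
  obtain ⟨h, -, hh⟩ := combinatorial_nullstellensatz_exists_linearCombination
    (fun _ : σ => (Finset.univ : Finset K)) (fun _ => Finset.univ_nonempty) p fun x _ => hp x
  rw [hh, Finsupp.linearCombination_apply, Finsupp.sum]
  refine sum_mem fun i _ => ?_
  rw [smul_eq_mul]
  refine Ideal.mul_mem_left _ _ ?_
  have h1 := congrArg (Polynomial.aeval (X i : MvPolynomial σ K)) (FiniteField.prod_X_sub_C K)
  simp only [map_prod, map_sub, map_pow, Polynomial.aeval_X, Polynomial.aeval_C,
    algebraMap_eq] at h1
  rw [h1]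
  exact Ideal.subset_span (Set.mem_range_self i)

theorem MvPolynomial.aeval_pow_card {K A σ : Type*} [Field K] [Fintype K] [CommRing A] [Algebra K A]
    (x : σ → A) (p : MvPolynomial σ K) :
    aeval (fun i => x i ^ Fintype.card K) p = aeval x p ^ Fintype.card K := by
  have : (FiniteField.frobeniusAlgHom K A).comp (aeval x) =
      aeval fun i => x i ^ Fintype.card K := by
    refine MvPolynomial.algHom_ext fun i => ?_
    simp
  exact (DFunLike.congr_fun this p).symm

theorem MvPolynomial.finSuccEquiv_map {R S : Type*} [CommRing R] [CommRing S] (φ : R →+* S) {r : ℕ}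
    (p : MvPolynomial (Fin (r + 1)) R) :
    finSuccEquiv S r (map φ p) = (finSuccEquiv R r p).map (map φ) := by
  induction p using MvPolynomial.induction_on with
  | C a => simp [finSuccEquiv_apply]
  | add p q hp hq => simp [hp, hq]
  | mul_X p i hp =>
    rw [map_mul, map_mul, map_mul, hp, Polynomial.map_mul, map_X]
    refine congrArg _ ?_
    refine Fin.cases ?_ (fun j => ?_) i
    · simp [finSuccEquiv_X_zero]
    · simp [finSuccEquiv_X_succ]

theorem MvPolynomial.eval₂_finSuccEquiv {R A : Type*} [CommRing R] [CommRing A] [Algebra R A] {r : ℕ}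
    (x : Fin r → A) (y : A) (p : MvPolynomial (Fin (r + 1)) R) :
    (finSuccEquiv R r p).eval₂ (aeval x : MvPolynomial (Fin r) R →ₐ[R] A) y =
      aeval (Fin.cons y x : Fin (r + 1) → A) p := by
  induction p using MvPolynomial.induction_on with
  | C a => simp [finSuccEquiv_apply]
  | add p q hp hq => simp [Polynomial.eval₂_add, hp, hq]
  | mul_X p i hp =>
    rw [map_mul, map_mul, Polynomial.eval₂_mul, hp, aeval_X]
    refine congrArg _ ?_
    refine Fin.cases ?_ (fun j => ?_) i
    · simp [finSuccEquiv_X_zero]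
    · simp [finSuccEquiv_X_succ]

variable {k : Type*} [Field k] {r : ℕ}

theorem AdjoinRoot.mk_finSuccEquiv (f : Polynomial (MvPolynomial (Fin r) k))
    (p : MvPolynomial (Fin (r + 1)) k) :
    AdjoinRoot.mk f (finSuccEquiv k r p) =
      aeval (Fin.cons (AdjoinRoot.root f) (fun i => AdjoinRoot.of f (X i)) :
        Fin (r + 1) → AdjoinRoot f) p := by
  rw [← eval₂_finSuccEquiv]
  have : ((aeval fun i => AdjoinRoot.of f (X i) : MvPolynomial (Fin r) k →ₐ[k] AdjoinRoot f) :
      MvPolynomial (Fin r) k →+* AdjoinRoot f) = AdjoinRoot.of f :=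
    RingHom.ext fun p => (AdjoinRoot.of_eq_aeval p).symm
  rw [this]
  induction finSuccEquiv k r p using Polynomial.induction_on' with
  | add p q hp hq => rw [map_add, Polynomial.eval₂_add, hp, hq]
  | monomial n a =>
    rw [Polynomial.eval₂_monomial, ← Polynomial.C_mul_X_pow_eq_monomial, map_mul, map_pow,
      AdjoinRoot.mk_C, AdjoinRoot.mk_X]

theorem AdjoinRoot.exists_powerMap {K : Type*} [Field K] [Fintype K] [Algebra K k]
    (G : MvPolynomial (Fin (r + 1)) K) {f : Polynomial (MvPolynomial (Fin r) k)}
    (hf : f = finSuccEquiv k r (MvPolynomial.map (algebraMap K k) G)) :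
    ∃ F : AdjoinRoot f →ₐ[k] AdjoinRoot f,
      (∀ i, F (AdjoinRoot.of f (X i)) = AdjoinRoot.of f (X i) ^ Fintype.card K) ∧
      F (AdjoinRoot.root f) = AdjoinRoot.root f ^ Fintype.card K := by
  have h : f.eval₂ (aeval fun i => AdjoinRoot.of f (X i) ^ Fintype.card K :
      MvPolynomial (Fin r) k →ₐ[k] AdjoinRoot f) (AdjoinRoot.root f ^ Fintype.card K) = 0 := by
    have h1 : (finSuccEquiv k r (MvPolynomial.map (algebraMap K k) G)).eval₂
        (aeval fun i => AdjoinRoot.of f (X i) ^ Fintype.card K :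
          MvPolynomial (Fin r) k →ₐ[k] AdjoinRoot f) (AdjoinRoot.root f ^ Fintype.card K) = 0 := by
      rw [eval₂_finSuccEquiv, aeval_map_algebraMap]
      have h2 : (Fin.cons (AdjoinRoot.root f ^ Fintype.card K)
          (fun i => AdjoinRoot.of f (X i) ^ Fintype.card K) : Fin (r + 1) → AdjoinRoot f) =
          fun j => (Fin.cons (AdjoinRoot.root f) (fun i => AdjoinRoot.of f (X i)) :
            Fin (r + 1) → AdjoinRoot f) j ^ Fintype.card K := by
        funext j
        exact Fin.cases rfl (fun i => rfl) j
      rw [h2, aeval_pow_card, ← aeval_map_algebraMap k, ← AdjoinRoot.mk_finSuccEquiv, ← hf,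
        AdjoinRoot.mk_self, zero_pow Fintype.card_ne_zero]
    rwa [← hf] at h1
  refine ⟨AdjoinRoot.liftAlgHom f _ _ h, fun i => ?_, ?_⟩
  · rw [AdjoinRoot.liftAlgHom_of, aeval_X]
  · simp

theorem exists_bound_exists_point_of_monic (r d e : ℕ) (hd : 1 ≤ d) : ∃ N : ℕ,
    ∀ (K : Type) [Field K] [Fintype K], N < Fintype.card K →
      ∀ G H : MvPolynomial (Fin (r + 1)) K,
      (finSuccEquiv K r G).Monic → (finSuccEquiv K r G).natDegree = d → G.totalDegree ≤ d →
      Polynomial.derivative (finSuccEquiv K r G) ≠ 0 →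
      Irreducible (map (algebraMap K (AlgebraicClosure K)) G) →
      H.totalDegree ≤ e → ¬ G ∣ H → ∃ x, eval x G = 0 ∧ eval x H ≠ 0 := by
  obtain ⟨N, hN⟩ := exists_bound_forall_eq_zero r d e hd
  refine ⟨N, fun K _ _ hq G H hmonic hdeg hGd hder hirr hHe hdvd => ?_⟩
  by_contra! hcon
  apply hdvd
  set k := AlgebraicClosure K
  set φ := algebraMap K k
  set f := finSuccEquiv k r (map φ G) with hf
  have hfmap : f = (finSuccEquiv K r G).map (map φ) := finSuccEquiv_map φ G
  have hinj : Function.Injective (map φ : MvPolynomial (Fin r) K →+* MvPolynomial (Fin r) k) :=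
    map_injective _ φ.injective
  obtain ⟨F, hFx, hFy⟩ := AdjoinRoot.exists_powerMap (k := k) G hf
  set q := Fintype.card K
  set x := fun i => AdjoinRoot.of f (X i) with hx
  set y := AdjoinRoot.root f with hydef
  have hmonic' : f.Monic := hfmap ▸ hmonic.map _
  have hdeg' : f.natDegree = d := by rw [hfmap, hmonic.natDegree_map, hdeg]
  have hcoeff : ∀ i ≤ d, (f.coeff i).totalDegree + i ≤ d := by
    intro i hi
    by_cases h0 : f.coeff i = 0
    · simpa [h0] using hi
    · exact (totalDegree_coeff_finSuccEquiv_add_le _ i h0).trans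
        ((totalDegree_map_le _ _).trans hGd)
  have hder' : Polynomial.derivative f ≠ 0 := by
    rw [hfmap, Polynomial.derivative_map]
    exact (Polynomial.map_ne_zero_iff hinj).2 hder
  have hirr' : Irreducible f := (MulEquiv.irreducible_iff (finSuccEquiv k r)).2 hirr
  have hy : y ^ d ∈ degreeFiltration k x y d d :=
    AdjoinRoot.root_pow_mem_degreeFiltration hmonic' hdeg' hcoeff
  set ev : MvPolynomial (Fin (r + 1)) K →ₐ[K] AdjoinRoot f :=
    aeval (Fin.cons y x : Fin (r + 1) → AdjoinRoot f) with hev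
  have hevk : ∀ p, ev p = aeval (Fin.cons y x : Fin (r + 1) → AdjoinRoot f) (map φ p) := fun p => by
    rw [hev, aeval_map_algebraMap]
  have hevG : ev G = 0 := by
    rw [hevk, ← AdjoinRoot.mk_finSuccEquiv, ← hf, AdjoinRoot.mk_self]
  have hfil : ev H ∈ degreeFiltration k x y d e := by
    rw [hevk]
    exact aeval_mem_degreeFiltration hd hy ((totalDegree_map_le _ _).trans hHe)
  have hvan : ∀ u, eval u (H - G ^ (q - 1) * H) = 0 := by
    intro u
    rw [map_sub, map_mul, map_pow]
    by_cases hu : eval u G = 0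
    · simp [hcon u hu]
    · rw [FiniteField.pow_card_sub_one_eq_one _ hu]
      simp
  have hmem : ev H ∈ Ideal.span {y ^ q - y} ⊔ Ideal.span (Set.range fun i => x i ^ q - x i) := by
    have h1 : ev (H - G ^ (q - 1) * H) = ev H := by
      have : q - 1 ≠ 0 := by
        have : 1 < q := Fintype.one_lt_card
        omega
      rw [map_sub, map_mul, map_pow, hevG, zero_pow this, zero_mul, sub_zero]
    rw [← h1]
    have h2 := Ideal.mem_map_of_mem ev (mem_span_of_forall_eval_eq_zero hvan)
    rw [Ideal.map_span] at h2
    refine (Ideal.span_le.2 ?_) h2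
    rintro _ ⟨_, ⟨i, rfl⟩, rfl⟩
    simp only [map_sub, map_pow, hev, aeval_X, SetLike.mem_coe]
    refine Fin.cases ?_ (fun j => ?_) i
    · exact Ideal.mem_sup_left (Ideal.subset_span rfl)
    · exact Ideal.mem_sup_right (Ideal.subset_span (Set.mem_range_self j))
  have hzero := hN k f hmonic' hdeg' hcoeff hder' hirr' q hq F hFx hFy (ev H) hfil hmem
  rw [hevk, ← AdjoinRoot.mk_finSuccEquiv, AdjoinRoot.mk_eq_zero, hfmap, finSuccEquiv_map,
    Polynomial.map_dvd_map _ hinj hmonic] at hzero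
  exact (map_dvd_iff (finSuccEquiv K r)).1 hzero

end FinitePoints

section LinearChange

theorem MvPolynomial.exists_pderiv_ne_zero {K L σ : Type*} [Field K] [Finite K] [Field L]
    (φ : K →+* L) {G : MvPolynomial σ K} (hG : Irreducible (map φ G)) :
    ∃ i, pderiv i G ≠ 0 := by
  by_contra! h
  obtain ⟨p, hp⟩ := CharP.exists K
  have hprime : Fact p.Prime := ⟨(CharP.char_is_prime_or_zero K p).resolve_right
    (CharP.char_ne_zero_of_finite K p)⟩
  have hdvd : ∀ m ∈ G.support, ∀ i, p ∣ m i := by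
    intro m hm i
    by_cases h0 : m i = 0
    · simp [h0]
    have h1 := coeff_pderiv (i := i) G (m - Finsupp.single i 1)
    have h2 : m - Finsupp.single i 1 + Finsupp.single i 1 = m := by
      refine tsub_add_cancel_of_le ?_
      rw [Finsupp.single_le_iff]
      omega
    rw [h i, coeff_zero, h2] at h1
    have h3 := (mul_eq_zero.1 h1.symm).resolve_left (mem_support_iff.1 hm)
    have h4 : ((m i : ℕ) : K) = 0 := by
      rw [← h2]
      simpa using h3
    exact (CharP.cast_eq_zero_iff K p _).1 h4
  choose! root hroot using surjective_frobenius K p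
  have hpow : G = (∑ m ∈ G.support, monomial (m.mapRange (· / p) (Nat.zero_div p))
      (root (coeff m G))) ^ p := by
    rw [← frobenius_def, map_sum]
    conv_lhs => rw [G.as_sum]
    refine Finset.sum_congr rfl fun m hm => ?_
    rw [frobenius_def, monomial_pow, ← frobenius_def, hroot]
    congr 2
    ext i
    simp [Nat.mul_div_cancel' (hdvd m hm i)]
  rw [hpow, map_pow] at hG
  exact not_irreducible_pow hprime.out.ne_one hG

theorem MvPolynomial.irreducible_of_map {K L σ : Type*} [Field K] [Field L] (φ : K →+* L)
    {G : MvPolynomial σ K} (hG : Irreducible (map φ G)) : Irreducible G := by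
  have : IsLocalHom (map φ : MvPolynomial σ K →+* MvPolynomial σ L) := by
    refine ⟨fun p hp => ?_⟩
    rw [isUnit_iff] at hp ⊢
    simp only [coeff_map, isNilpotent_iff_eq_zero, isUnit_iff_ne_zero, map_ne_zero,
      map_eq_zero] at hp ⊢
    exact hp
  exact Irreducible.of_map hG

theorem MvPolynomial.derivative_finSuccEquiv {R : Type*} [CommRing R] {r : ℕ}
    (p : MvPolynomial (Fin (r + 1)) R) :
    Polynomial.derivative (finSuccEquiv R r p) = finSuccEquiv R r (pderiv 0 p) := by
  induction p using MvPolynomial.induction_on with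
  | C a => simp [finSuccEquiv_apply]
  | add p q hp hq => simp [hp, hq]
  | mul_X p i hp =>
    rw [map_mul, Polynomial.derivative_mul, hp, pderiv_mul, map_add, map_mul, map_mul]
    refine congrArg _ (congrArg _ ?_)
    refine Fin.cases ?_ (fun j => ?_) i
    · simp [finSuccEquiv_X_zero]
    · rw [pderiv_X_of_ne (Fin.succ_ne_zero j)]
      simp [finSuccEquiv_X_succ]

theorem MvPolynomial.IsHomogeneous.eval_single {R σ : Type*} [CommRing R] [DecidableEq σ] [Fintype σ]
    {p : MvPolynomial σ R} {d : ℕ} (hp : p.IsHomogeneous d) (i : σ) :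
    eval (Pi.single i 1) p = coeff (Finsupp.single i d) p := by
  rw [eval_eq']
  rw [Finset.sum_eq_single (Finsupp.single i d)]
  · rw [Finset.prod_eq_one, mul_one]
    intro j _
    by_cases h : j = i
    · subst h
      simp
    · simp [Finsupp.single_eq_of_ne h]
  · intro m hm hne
    have : ∃ j, j ≠ i ∧ m j ≠ 0 := by
      by_contra! h
      apply hne
      have hms : m = Finsupp.single i (m i) := by
        ext j
        by_cases hj : j = i
        · subst hj
          simp
        · rw [Finsupp.single_eq_of_ne hj, h j hj]
      have hdeg := hp (mem_support_iff.1 hm)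
      rw [hms] at hdeg ⊢
      rw [Finsupp.weight_single] at hdeg
      have hmi : m i = d := by simpa using hdeg
      rw [hmi]
    obtain ⟨j, hj, hmj⟩ := this
    rw [Finset.prod_eq_zero (Finset.mem_univ j), mul_zero]
    rw [Pi.single_eq_of_ne hj, zero_pow hmj]
  · intro h
    rw [notMem_support_iff.1 h, zero_mul]

variable {K : Type*} [Field K] {r : ℕ}

/-- The images of the variables under the linear substitution carrying `X 0` to `c 0 X 0` and
`X (i + 1)` to `X (i + 1) + c (i + 1) X 0`. -/
noncomputable def linChangeVars (c : Fin (r + 1) → K) : Fin (r + 1) → MvPolynomial (Fin (r + 1)) K :=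
  Fin.cons (C (c 0) * X 0) fun i => X i.succ + C (c i.succ) * X 0

/-- The linear change of variables given by `linChangeVars`. -/
noncomputable def linChange (c : Fin (r + 1) → K) (hc : c 0 ≠ 0) :
    MvPolynomial (Fin (r + 1)) K ≃ₐ[K] MvPolynomial (Fin (r + 1)) K :=
  AlgEquiv.ofAlgHom (aeval (linChangeVars c))
    (aeval (Fin.cons (C (c 0)⁻¹ * X 0) fun i => X i.succ - C (c i.succ * (c 0)⁻¹) * X 0 :
      Fin (r + 1) → MvPolynomial (Fin (r + 1)) K))
    (by
      have hcc : (C (c 0)⁻¹ * C (c 0) : MvPolynomial (Fin (r + 1)) K) = 1 := by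
        rw [← C_mul, inv_mul_cancel₀ hc, C_1]
      refine MvPolynomial.algHom_ext fun i => ?_
      refine Fin.cases ?_ (fun j => ?_) i <;>
        simp only [linChangeVars, AlgHom.comp_apply, aeval_X, Fin.cons_zero, Fin.cons_succ,
          map_mul, map_sub, algHom_C, algebraMap_eq, AlgHom.id_apply]
      · linear_combination X 0 * hcc
      · linear_combination -C (c j.succ) * X 0 * hcc)
    (by
      have hcc : (C (c 0)⁻¹ * C (c 0) : MvPolynomial (Fin (r + 1)) K) = 1 := by
        rw [← C_mul, inv_mul_cancel₀ hc, C_1]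
      refine MvPolynomial.algHom_ext fun i => ?_
      refine Fin.cases ?_ (fun j => ?_) i <;>
        simp only [linChangeVars, AlgHom.comp_apply, aeval_X, Fin.cons_zero, Fin.cons_succ,
          map_mul, map_add, algHom_C, algebraMap_eq, AlgHom.id_apply]
      · linear_combination X 0 * hcc
      · ring)

variable {c : Fin (r + 1) → K} {hc : c 0 ≠ 0}

theorem linChange_apply (p : MvPolynomial (Fin (r + 1)) K) :
    linChange c hc p = aeval (linChangeVars c) p := rfl

theorem map_linChange {L : Type*} [Field L] (φ : K →+* L) (p : MvPolynomial (Fin (r + 1)) K) :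
    map φ (linChange c hc p) =
      linChange (fun i => φ (c i)) ((map_ne_zero φ).2 hc) (map φ p) := by
  induction p using MvPolynomial.induction_on with
  | C a => simp [linChange_apply, algebraMap_eq]
  | add p q hp hq => simp [hp, hq]
  | mul_X p i hp =>
    rw [map_mul, map_mul, map_mul, map_mul, hp, map_X]
    refine congrArg _ ?_
    refine Fin.cases ?_ (fun j => ?_) i
    · simp [linChange_apply, linChangeVars]
    · simp [linChange_apply, linChangeVars]

theorem eval_linChange (u : Fin (r + 1) → K) (p : MvPolynomial (Fin (r + 1)) K) :
    eval u (linChange c hc p) = eval (fun i => eval u (linChangeVars c i)) p := by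
  rw [linChange_apply, ← aeval_eq_eval, ← aeval_eq_eval, ← AlgHom.comp_apply, comp_aeval]

theorem eval_single_linChange (p : MvPolynomial (Fin (r + 1)) K) :
    eval (Pi.single 0 1) (linChange c hc p) = eval c p := by
  rw [eval_linChange]
  refine congrArg (fun v => eval v p) ?_
  funext i
  refine Fin.cases ?_ (fun j => ?_) i
  · simp [linChangeVars]
  · simp [linChangeVars]

theorem isHomogeneous_linChange {p : MvPolynomial (Fin (r + 1)) K} {m : ℕ}
    (hp : p.IsHomogeneous m) : (linChange c hc p).IsHomogeneous m := by
  rw [linChange_apply, ← one_mul m]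
  refine hp.aeval _ fun i => ?_
  refine Fin.cases ?_ (fun j => ?_) i
  · exact isHomogeneous_C_mul_X _ _
  · exact (isHomogeneous_X _ _).add (isHomogeneous_C_mul_X _ _)

theorem pderiv_linChange (p : MvPolynomial (Fin (r + 1)) K) :
    pderiv 0 (linChange c hc p) = linChange c hc (∑ i, C (c i) * pderiv i p) := by
  have hX : ∀ i, pderiv 0 (linChange c hc (X i)) = C (c i) := by
    intro i
    refine Fin.cases ?_ (fun j => ?_) i
    · simp [linChange_apply, linChangeVars]
    · simp [linChange_apply, linChangeVars, pderiv_X_of_ne (Fin.succ_ne_zero j)]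
  induction p using MvPolynomial.induction_on with
  | C a => simp [linChange_apply, algebraMap_eq]
  | add p q hp hq => simp only [map_add, hp, hq, mul_add, Finset.sum_add_distrib]
  | mul_X p i hp =>
    have : ∑ j, C (c j) * pderiv j (p * X i) =
        (∑ j, C (c j) * pderiv j p) * X i + p * C (c i) := by
      simp only [pderiv_mul, mul_add, Finset.sum_add_distrib, Finset.sum_mul, pderiv_X, mul_assoc]
      congr 1
      rw [Finset.sum_eq_single i]
      · simp [mul_comm]
      · intro j _ hj
        simp [Pi.single_eq_of_ne (Ne.symm hj)]
      · simp
    have hC : linChange c hc (C (c i)) = C (c i) := by simp [linChange_apply, algebraMap_eq]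
    rw [this, map_mul, pderiv_mul, hp, hX, map_add, map_mul, map_mul, hC]

theorem exists_direction [Fintype K] {d : ℕ} (hq : d + 2 < Fintype.card K)
    {G : MvPolynomial (Fin (r + 1)) K} (hG : G ≠ 0) (hGd : G.totalDegree ≤ d) {j : Fin (r + 1)}
    (hj : pderiv j G ≠ 0) :
    ∃ c : Fin (r + 1) → K, c 0 ≠ 0 ∧ eval c G ≠ 0 ∧ ∑ i, C (c i) * pderiv i G ≠ 0 := by
  obtain ⟨β, hβ⟩ := ne_zero_iff.1 hj
  set l : MvPolynomial (Fin (r + 1)) K := ∑ i, C (coeff β (pderiv i G)) * X i with hl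
  have hl_eval : ∀ u, eval u l = coeff β (∑ i, C (u i) * pderiv i G) := by
    intro u
    simp only [hl, map_sum, map_mul, eval_C, eval_X, coeff_sum, coeff_C_mul]
    exact Finset.sum_congr rfl fun i _ => mul_comm _ _
  have hl0 : l ≠ 0 := by
    intro h0
    apply hβ
    have := hl_eval (Pi.single j 1)
    rw [h0, map_zero, Finset.sum_eq_single j] at this
    · simpa using this.symm
    · intro i _ hi
      simp [Pi.single_eq_of_ne hi]
    · simp
  have hldeg : l.totalDegree ≤ 1 :=
    IsHomogeneous.totalDegree_le (IsHomogeneous.sum _ _ _ fun i _ => isHomogeneous_C_mul_X _ _)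
  have hdeg : (X 0 * G * l).totalDegree ≤ d + 2 := by
    have h1 := totalDegree_mul (X 0 * G) l
    have h2 := totalDegree_mul (X 0) G
    rw [totalDegree_X] at h2
    omega
  have hne : X 0 * G * l ≠ 0 := mul_ne_zero (mul_ne_zero (X_ne_zero 0) hG) hl0
  obtain ⟨c, hc⟩ : ∃ c, eval c (X 0 * G * l) ≠ 0 := by
    by_contra! h
    refine hne (eq_zero_of_eval_zero_at_prod_finset _ (fun _ => Finset.univ) (fun i => ?_)
      fun x _ => h x)
    rw [Finset.card_univ]
    exact ((degreeOf_le_totalDegree _ i).trans hdeg).trans_lt hq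
  rw [map_mul, map_mul, eval_X, hl_eval] at hc
  refine ⟨c, left_ne_zero_of_mul (left_ne_zero_of_mul hc),
    right_ne_zero_of_mul (left_ne_zero_of_mul hc), fun h => ?_⟩
  rw [h, coeff_zero, mul_zero] at hc
  exact hc rfl

theorem MvPolynomial.IsHomogeneous.monic_finSuccEquiv {d : ℕ} {P : MvPolynomial (Fin (r + 1)) K}
    (hP : P.IsHomogeneous d) (h1 : eval (Pi.single 0 1) P = 1) :
    (finSuccEquiv K r P).Monic ∧ (finSuccEquiv K r P).natDegree = d := by
  have hle : (finSuccEquiv K r P).natDegree ≤ d := by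
    rw [natDegree_finSuccEquiv]
    exact (degreeOf_le_totalDegree P 0).trans hP.totalDegree_le
  have hcoeff : (finSuccEquiv K r P).coeff d = 1 := by
    have h2 := (totalDegree_zero_iff_isHomogeneous _).2
      (hP.finSuccEquiv_coeff_isHomogeneous d 0 (add_zero d))
    rw [totalDegree_eq_zero_iff_eq_C, finSuccEquiv_coeff_coeff] at h2
    have h3 : Finsupp.cons d (0 : Fin r →₀ ℕ) = Finsupp.single 0 d := by
      ext i
      refine Fin.cases ?_ (fun j => ?_) i
      · simp
      · simp [Finsupp.single_eq_of_ne (Fin.succ_ne_zero j)]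
    rw [h2, h3, ← hP.eval_single, h1, C_1]
  exact ⟨Polynomial.monic_of_natDegree_le_of_coeff_eq_one d hle hcoeff,
    Polynomial.natDegree_eq_of_le_of_coeff_ne_zero hle (by simp [hcoeff])⟩

end LinearChange

/-- **Theorem (Lewis & Schuur, 1973).** Fix `n ≥ 3`, `d ≥ 1`, `e ≥ 1`.  There is a constant
`A = A(d,e)` such that for every finite field `𝔽_q` with `q > A`, every absolutely
irreducible homogeneous polynomial `G` of degree `d` in `n` variables over `𝔽_q` and every
homogeneous polynomial `H` of degree `e` not divisible by `G`, there is an `𝔽_q`-point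
which is a non-singular zero of `G` and not a zero of `H`. -/
theorem lewis_schuur {n d e : ℕ} (hn : 3 ≤ n) (hd : 1 ≤ d) (he : 1 ≤ e) :
    ∃ A : ℝ, ∀ (K : Type) [Field K] [Fintype K], A < (Fintype.card K : ℝ) →
      ∀ G H : MvPolynomial (Fin n) K,
        G.totalDegree = d → G.IsHomogeneous d →
        H.totalDegree = e → H.IsHomogeneous e →
        Irreducible (MvPolynomial.map (algebraMap K (AlgebraicClosure K)) G) →
        ¬ G ∣ H →
        ∃ x : Fin n → K,
          eval x G = 0 ∧ (∃ i : Fin n, eval x (pderiv i G) ≠ 0) ∧ eval x H ≠ 0 := by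
  obtain ⟨r, rfl⟩ : ∃ r, n = r + 1 := ⟨n - 1, by omega⟩
  obtain ⟨N, hN⟩ := exists_bound_exists_point_of_monic r d (e + d) hd
  refine ⟨((N + d + 2 : ℕ) : ℝ), fun K _ _ hK G H hGd hG hHe hH hirr hdvd => ?_⟩
  rw [Nat.cast_lt] at hK
  have hirrK := irreducible_of_map _ hirr
  obtain ⟨j, hj⟩ := exists_pderiv_ne_zero _ hirr
  obtain ⟨c, hc, hcG, hcD⟩ := exists_direction (d := d) (by omega) hirrK.ne_zero hGd.le hj
  set g := eval c G with hg
  have hunit : IsUnit (C g⁻¹ : MvPolynomial (Fin (r + 1)) K) :=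
    (IsUnit.mk0 _ (inv_ne_zero hcG)).map C
  set P := linChange c hc (C g⁻¹ * G) with hP
  have hPhom : P.IsHomogeneous d := isHomogeneous_linChange (hG.C_mul _)
  have hPone : eval (Pi.single 0 1) P = 1 := by
    rw [hP, eval_single_linChange, map_mul, eval_C, ← hg, inv_mul_cancel₀ hcG]
  obtain ⟨hmonic, hdeg⟩ := hPhom.monic_finSuccEquiv hPone
  have hder : Polynomial.derivative (finSuccEquiv K r P) ≠ 0 := by
    rw [derivative_finSuccEquiv, hP, pderiv_linChange]
    rw [Ne, map_eq_zero_iff _ (finSuccEquiv K r).injective,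
      map_eq_zero_iff _ (linChange c hc).injective]
    simp only [pderiv_C_mul, mul_left_comm _ (C g⁻¹), ← Finset.mul_sum]
    exact mul_ne_zero hunit.ne_zero hcD
  have hPirr : Irreducible (MvPolynomial.map (algebraMap K (AlgebraicClosure K)) P) := by
    rw [hP, map_linChange, MulEquiv.irreducible_iff, map_mul]
    exact (irreducible_isUnit_mul (hunit.map _)).2 hirr
  have hjdvd : ¬ G ∣ pderiv j G := by
    rintro ⟨v, hv⟩
    have hv0 : v ≠ 0 := by
      rintro rfl
      exact hj (by rw [hv, mul_zero])
    have h1 := (hG.pderiv (i := j)).totalDegree_le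
    rw [hv, totalDegree_mul_of_isDomain hirrK.ne_zero hv0] at h1
    omega
  have hPdvd : ¬ P ∣ linChange c hc (H * pderiv j G) := by
    rw [hP, map_dvd_iff, hunit.mul_left_dvd]
    exact fun h => (hirrK.prime.dvd_or_dvd h).elim hdvd hjdvd
  have hHdeg : (linChange c hc (H * pderiv j G)).totalDegree ≤ e + d := by
    have := (isHomogeneous_linChange (hc := hc) (hH.mul (hG.pderiv (i := j)))).totalDegree_le
    omega
  obtain ⟨u, hu, hu2⟩ := hN K (by omega) P _ hmonic hdeg hPhom.totalDegree_le hder hPirr hHdeg hPdvd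
  rw [hP, eval_linChange, map_mul, eval_C] at hu
  rw [eval_linChange, map_mul] at hu2
  exact ⟨_, (mul_eq_zero.1 hu).resolve_left (inv_ne_zero hcG),
    ⟨j, right_ne_zero_of_mul hu2⟩, left_ne_zero_of_mul hu2⟩
end

section
/- Let q be a prime power, 𝔽_q the finite field with q elements, and n ≥ 2. Let F₁, F₂ ∈ 𝔽_q[x_1,…,x_n] be non-zero polynomials of total degrees d₁ and d₂ respectively which have no common non-unit factor in 𝔽̄_q[x_1,…,x_n], where 𝔽̄_q is an algebraic closure of 𝔽_q. Then #{x ∈ 𝔽_q^n : F₁(x) = 0 and F₂(x) = 0} ≤ d₁·d₂·q^{n−2}. -/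
open MvPolynomial

section Order

variable {σ K : Type*} [Field K]

theorem card_degree_le_s4 (n D : ℕ) :
    Nat.card {u : Fin n →₀ ℕ | u.degree ≤ D} = (D + n).choose n := by
  classical
  have hset : {u : Fin n →₀ ℕ | u.degree ≤ D} =
      ((Finset.range (D + 1)).biUnion fun d => Finset.univ.finsuppAntidiag d :
        Finset (Fin n →₀ ℕ)) := by
    ext u
    simp [Finset.mem_finsuppAntidiag, Finsupp.degree_eq_sum]
  have hsum (D : ℕ) : ∑ d ∈ Finset.range (D + 1), n.multichoose d = (n + 1).multichoose D := by
    induction D with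
    | zero => simp
    | succ D ih =>
      rw [Finset.sum_range_succ, ih, Nat.multichoose_succ_succ, add_comm]
  rw [hset, Nat.card_eq_card_toFinset, Finset.toFinset_coe, Finset.card_biUnion]
  · simp only [Finset.card_finsuppAntidiag_nat_eq_multichoose, Finset.card_univ, Fintype.card_fin]
    rw [hsum, Nat.multichoose_eq, Nat.add_right_comm, Nat.add_sub_cancel, add_comm n D,
      Nat.choose_symm_add]
  · intro a _ b _ hab
    rw [Function.onFun, Finset.disjoint_left]
    intro u hu hu'
    simp only [Finset.mem_finsuppAntidiag] at hu hu'
    exact hab (hu.1.symm.trans hu'.1)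

theorem finrank_restrictTotalDegree (n D : ℕ) :
    Module.finrank K (restrictTotalDegree (Fin n) K D) = (D + n).choose n := by
  rw [restrictTotalDegree, Module.finrank_eq_nat_card_basis (basisRestrictSupport K _),
    ← card_degree_le_s4]
  congr!

/-- The polynomials vanishing at the origin to order at least `k`, as a `K`-subspace. -/
noncomputable def powVars (σ K : Type*) [Field K] (k : ℕ) : Submodule K (MvPolynomial σ K) :=
  (idealOfVars σ K ^ k).restrictScalars K

theorem mem_powVars {k : ℕ} {p : MvPolynomial σ K} :
    p ∈ powVars σ K k ↔ p ∈ idealOfVars σ K ^ k := Iff.rfl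

theorem isCompl_restrictTotalDegree_powVars (D : ℕ) :
    IsCompl (powVars σ K (D + 1)) (restrictTotalDegree σ K D) := by
  constructor
  · rw [Submodule.disjoint_def]
    intro p hp hp'
    rw [mem_powVars, mem_pow_idealOfVars_iff] at hp
    rw [← support_eq_empty, Finset.eq_empty_iff_forall_notMem]
    intro u hu
    have h1 := hp u hu
    have h2 : u.degree ≤ D := hp' hu
    omega
  · rw [codisjoint_iff, eq_top_iff]
    intro p _
    induction p using MvPolynomial.monomial_add_induction_on with
    | C a =>
      refine Submodule.mem_sup_right ?_
      simp [mem_restrictTotalDegree]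
    | monomial_add u a f _ _ hf =>
      refine add_mem ?_ (hf trivial)
      by_cases hu : u.degree ≤ D
      · refine Submodule.mem_sup_right ?_
        rw [mem_restrictTotalDegree]
        exact (totalDegree_monomial_le _ _).trans hu
      · refine Submodule.mem_sup_left ?_
        by_cases ha : a = 0
        · simp [ha]
        rw [mem_powVars, monomial_mem_pow_idealOfVars_iff _ _ ha]
        omega

theorem finrank_quotient_powVars (n D : ℕ) :
    Module.finrank K (MvPolynomial (Fin n) K ⧸ powVars (Fin n) K (D + 1)) = (D + n).choose n := by
  rw [← finrank_restrictTotalDegree (K := K)]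
  exact (Submodule.quotientEquivOfIsCompl _ _
    (isCompl_restrictTotalDegree_powVars D)).finrank_eq

instance (n D : ℕ) :
    Module.Finite K (MvPolynomial (Fin n) K ⧸ powVars (Fin n) K (D + 1)) :=
  Module.Finite.equiv (Submodule.quotientEquivOfIsCompl _ _
    (isCompl_restrictTotalDegree_powVars D)).symm

/-- `G` vanishes to order exactly `μ` at the origin. -/
def HasOrder (G : MvPolynomial σ K) (μ : ℕ) : Prop :=
  ∀ k a, G * a ∈ idealOfVars σ K ^ (k + μ) ↔ a ∈ idealOfVars σ K ^ k

theorem mem_pow_idealOfVars_iff_le_order (k : ℕ) (p : MvPolynomial σ K) :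
    p ∈ idealOfVars σ K ^ k ↔ (k : ℕ∞) ≤ (p : MvPowerSeries σ K).order := by
  rw [mem_pow_idealOfVars_iff']
  constructor
  · intro h
    exact MvPowerSeries.nat_le_order fun d hd => by simpa using h d hd
  · intro h d hd
    rw [← coeff_coe]
    exact MvPowerSeries.coeff_of_lt_order (lt_of_lt_of_le (by exact_mod_cast hd) h)

theorem exists_hasOrder {G : MvPolynomial σ K} (hG : G ≠ 0) : ∃ μ, HasOrder G μ := by
  have hne : (G : MvPowerSeries σ K) ≠ 0 := by simpa using hG
  obtain ⟨μ, hμ⟩ := ENat.ne_top_iff_exists.1 (mt MvPowerSeries.order_eq_top_iff.1 hne)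
  refine ⟨μ, fun k a => ?_⟩
  rw [mem_pow_idealOfVars_iff_le_order, mem_pow_idealOfVars_iff_le_order, coe_mul,
    MvPowerSeries.order_mul, ← hμ, Nat.cast_add, add_comm (μ : ℕ∞)]
  exact ENat.add_le_add_iff_right (ENat.natCast_ne_top μ)

theorem HasOrder.mul {G H : MvPolynomial σ K} {μ ν : ℕ} (hG : HasOrder G μ) (hH : HasOrder H ν) :
    HasOrder (G * H) (μ + ν) := fun k a => by
  rw [mul_assoc, add_comm μ, ← add_assoc, hG, hH]

theorem HasOrder.pos {G : MvPolynomial σ K} {μ : ℕ} (hG : HasOrder G μ)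
    (h : G ∈ idealOfVars σ K) : 0 < μ := by
  by_contra! h0
  obtain rfl : μ = 0 := by omega
  have := (hG 1 1).1 (by simpa using h)
  rw [← C_1, C_mem_pow_idealOfVars_iff] at this
  simp at this

/-- The image of the principal ideal `(G)` modulo the polynomials of order at least `k`. -/
noncomputable def principalImage (G : MvPolynomial σ K) (k : ℕ) :
    Submodule K (MvPolynomial σ K ⧸ powVars σ K k) :=
  LinearMap.range ((powVars σ K k).mkQ ∘ₗ LinearMap.mulLeft K G)

theorem finrank_principalImage {n μ : ℕ} {G : MvPolynomial (Fin n) K} (hG : HasOrder G μ) (k : ℕ) :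
    Module.finrank K (principalImage G (k + μ + 1)) = (k + n).choose n := by
  rw [← finrank_quotient_powVars (K := K), principalImage,
    ← (LinearMap.quotKerEquivRange _).finrank_eq]
  refine (Submodule.quotEquivOfEq _ _ ?_).finrank_eq
  ext a
  rw [LinearMap.ker_comp, Submodule.ker_mkQ, Submodule.mem_comap, mem_powVars, mem_powVars,
    LinearMap.mulLeft_apply, add_right_comm, hG]

theorem le_finrank_quotient_principalImage {n μ ν : ℕ} {G H : MvPolynomial (Fin n) K}
    (hG : HasOrder G μ) (hH : HasOrder H ν) (m : ℕ) :
    (m + μ + ν + n).choose n + (m + n).choose n ≤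
      Module.finrank K (_ ⧸ (principalImage G (m + μ + ν + 1) ⊔ principalImage H (m + μ + ν + 1)))
        + (m + ν + n).choose n + (m + μ + n).choose n := by
  have h1 := Submodule.finrank_quotient_add_finrank
    (principalImage G (m + μ + ν + 1) ⊔ principalImage H (m + μ + ν + 1))
  have h2 := Submodule.finrank_sup_add_finrank_inf_eq
    (principalImage G (m + μ + ν + 1)) (principalImage H (m + μ + ν + 1))
  have h3 : principalImage (G * H) (m + μ + ν + 1) ≤
      principalImage G (m + μ + ν + 1) ⊓ principalImage H (m + μ + ν + 1) := by
    rintro _ ⟨a, rfl⟩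
    refine ⟨⟨H * a, ?_⟩, ⟨G * a, ?_⟩⟩
    · simp
    · simp [mul_left_comm]
  have h4 := Submodule.finrank_mono h3
  rw [finrank_quotient_powVars] at h1
  have h5 := finrank_principalImage (hG.mul hH) m
  rw [← add_assoc] at h5
  have h6 := finrank_principalImage hH (m + μ)
  have h7 := finrank_principalImage hG (m + ν)
  rw [add_right_comm m ν μ] at h7
  omega

theorem finrank_add_le_of_isRelPrime {n d₁ d₂ : ℕ} {F₁ F₂ : MvPolynomial (Fin n) K}
    (hF₁ : F₁ ≠ 0) (hF₂ : F₂ ≠ 0) (hd₁ : F₁.totalDegree = d₁) (hd₂ : F₂.totalDegree = d₂)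
    (hcop : IsRelPrime F₁ F₂) {T : Type*} [AddCommGroup T] [Module K T]
    (Φ : MvPolynomial (Fin n) K →ₗ[K] T) (h₁ : ∀ a, Φ (F₁ * a) = 0) (h₂ : ∀ a, Φ (F₂ * a) = 0)
    (k : ℕ) (hΦ : (restrictTotalDegree (Fin n) K (k + d₁ + d₂)).map Φ = ⊤) :
    Module.finrank K T + (k + d₂ + n).choose n + (k + d₁ + n).choose n ≤
      (k + d₁ + d₂ + n).choose n + (k + n).choose n := by
  set P := restrictTotalDegree (Fin n) K
  let U (F : MvPolynomial (Fin n) K) (e : ℕ) := (P e).map (LinearMap.mulLeft K F)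
  have hU (F : MvPolynomial (Fin n) K) (hF : F ≠ 0) (e : ℕ) :
      Module.finrank K (U F e) = (e + n).choose n := by
    rw [← finrank_restrictTotalDegree (K := K)]
    exact (Submodule.equivMapOfInjective (LinearMap.mulLeft K F)
      (mul_right_injective₀ hF) (P e)).finrank_eq.symm
  have hinf : U F₁ (k + d₂) ⊓ U F₂ (k + d₁) ≤ U (F₁ * F₂) k := by
    rintro x ⟨⟨a, ha, rfl⟩, ⟨b, hb, hab⟩⟩
    simp only [LinearMap.mulLeft_apply] at hab ⊢
    obtain ⟨c, rfl⟩ : F₂ ∣ a := hcop.symm.dvd_of_dvd_mul_left ⟨b, hab.symm⟩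
    refine ⟨c, ?_, by simp⟩
    by_cases hc : c = 0
    · simp [hc]
    simp only [P, SetLike.mem_coe, mem_restrictTotalDegree] at ha ⊢
    rw [totalDegree_mul_of_isDomain hF₂ hc] at ha
    omega
  have hle : U F₁ (k + d₂) ⊔ U F₂ (k + d₁) ≤ P (k + d₁ + d₂) := by
    refine sup_le ?_ ?_
    all_goals
      rintro _ ⟨a, ha, rfl⟩
      simp only [P, SetLike.mem_coe, mem_restrictTotalDegree, LinearMap.mulLeft_apply] at ha ⊢
      have := totalDegree_mul F₁ a
      have := totalDegree_mul F₂ a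
      omega
  have hker : U F₁ (k + d₂) ⊔ U F₂ (k + d₁) ≤ LinearMap.ker Φ := by
    refine sup_le ?_ ?_
    · rintro _ ⟨a, -, rfl⟩
      exact h₁ a
    · rintro _ ⟨a, -, rfl⟩
      exact h₂ a
  have hfin := LinearMap.finrank_range_add_finrank_ker (Φ.domRestrict (P (k + d₁ + d₂)))
  have hrange : LinearMap.range (Φ.domRestrict (P (k + d₁ + d₂))) = ⊤ := by
    rw [← hΦ, LinearMap.domRestrict, LinearMap.range_comp, Submodule.range_subtype]
  rw [hrange, finrank_top, finrank_restrictTotalDegree] at hfin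
  have hkerle : Module.finrank K ↥(U F₁ (k + d₂) ⊔ U F₂ (k + d₁)) ≤
      Module.finrank K (LinearMap.ker (Φ.domRestrict (P (k + d₁ + d₂)))) := by
    rw [← (Submodule.comapSubtypeEquivOfLe hle).finrank_eq]
    refine Submodule.finrank_mono ?_
    intro x hx
    exact hker hx
  have h3 := Submodule.finrank_mono hinf
  have h4 := Submodule.finrank_sup_add_finrank_inf_eq (U F₁ (k + d₂)) (U F₂ (k + d₁))
  rw [hU _ hF₁, hU _ hF₂] at h4
  rw [hU _ (mul_ne_zero hF₁ hF₂)] at h3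
  omega

end Order

theorem choose_succ_add_eq_add_sum (r M b : ℕ) :
    (M + b + r + 1).choose (r + 1) = (M + r + 1).choose (r + 1)
      + ∑ j ∈ Finset.range b, (M + j + 1 + r).choose r := by
  induction b with
  | zero => simp
  | succ b ih =>
    rw [Finset.sum_range_succ, ← add_assoc ((M + r + 1).choose _), ← ih,
      show M + (b + 1) + r + 1 = (M + b + r + 1) + 1 by ring, Nat.choose_succ_succ,
      Nat.add_comm (Nat.choose _ _), show M + b + 1 + r = M + b + r + 1 by ring]

theorem choose_second_difference (r m a b : ℕ) :
    (m + a + b + (r + 2)).choose (r + 2) + (m + (r + 2)).choose (r + 2) =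
      (m + a + (r + 2)).choose (r + 2) + (m + b + (r + 2)).choose (r + 2)
      + ∑ j ∈ Finset.range b, ∑ i ∈ Finset.range a, (m + j + 1 + i + 1 + r).choose r := by
  have h1 := choose_succ_add_eq_add_sum (r + 1) (m + a) b
  have h2 := choose_succ_add_eq_add_sum (r + 1) m b
  have h3 : ∑ j ∈ Finset.range b, (m + a + j + 1 + (r + 1)).choose (r + 1) =
      ∑ j ∈ Finset.range b, (m + j + 1 + (r + 1)).choose (r + 1) +
      ∑ j ∈ Finset.range b, ∑ i ∈ Finset.range a, (m + j + 1 + i + 1 + r).choose r := by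
    rw [← Finset.sum_add_distrib]
    refine Finset.sum_congr rfl fun j _ => ?_
    have := choose_succ_add_eq_add_sum r (m + j + 1) a
    rw [show m + a + j + 1 + (r + 1) = m + j + 1 + a + r + 1 by ring, this]
    rfl
  simp only [add_assoc, Nat.reduceAdd] at h1 h2 h3 ⊢
  omega

theorem choose_second_difference_le (r m a b : ℕ) :
    (m + a + b + (r + 2)).choose (r + 2) + (m + (r + 2)).choose (r + 2) ≤
      (m + a + (r + 2)).choose (r + 2) + (m + b + (r + 2)).choose (r + 2)
      + a * b * (m + a + b + r).choose r := by
  rw [choose_second_difference, add_le_add_iff_left]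
  calc _ ≤ ∑ j ∈ Finset.range b, ∑ i ∈ Finset.range a, (m + a + b + r).choose r := by
        refine Finset.sum_le_sum fun j hj => Finset.sum_le_sum fun i hi => Nat.choose_le_choose r ?_
        simp only [Finset.mem_range] at hi hj
        omega
    _ = _ := by simp; ring

theorem le_choose_second_difference (r m : ℕ) {a b : ℕ} (ha : 0 < a) (hb : 0 < b) :
    (m + a + (r + 2)).choose (r + 2) + (m + b + (r + 2)).choose (r + 2) + (m + r).choose r ≤
      (m + a + b + (r + 2)).choose (r + 2) + (m + (r + 2)).choose (r + 2) := by
  rw [choose_second_difference, add_le_add_iff_left]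
  calc (m + r).choose r ≤ a * b * (m + r).choose r := Nat.le_mul_of_pos_left _ (by positivity)
    _ = ∑ j ∈ Finset.range b, ∑ i ∈ Finset.range a, (m + r).choose r := by simp; ring
    _ ≤ _ := Finset.sum_le_sum fun j hj => Finset.sum_le_sum fun i hi =>
        Nat.choose_le_choose r (by omega)

theorem le_mul_pow_of_forall_choose_le {N e q c r : ℕ}
    (h : ∀ m, N * (m + r).choose r ≤ e * (q * m + c + r).choose r) : N ≤ e * q ^ r := by
  have h' (m : ℕ) : N * (m + 1) ^ r ≤ e * (q * m + c + r) ^ r := by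
    calc N * (m + 1) ^ r ≤ N * (r.factorial * (m + r).choose r) := by
          rw [← Nat.ascFactorial_eq_factorial_mul_choose]
          gcongr
          exact Nat.pow_succ_le_ascFactorial _ _
      _ = r.factorial * (N * (m + r).choose r) := by ring
      _ ≤ r.factorial * (e * (q * m + c + r).choose r) := Nat.mul_le_mul_left _ (h m)
      _ = e * (r.factorial * (q * m + c + r).choose r) := by ring
      _ ≤ e * (q * m + c + r) ^ r := by
          rw [← Nat.ascFactorial_eq_factorial_mul_choose]
          gcongr
          exact Nat.ascFactorial_le_pow_add _ _
  have hlim : Filter.Tendsto (fun m : ℕ => (e : ℝ) * (q + (c + r) * (1 / ((m : ℝ) + 1))) ^ r)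
      Filter.atTop (nhds ((e : ℝ) * (q + (c + r) * 0) ^ r)) :=
    ((tendsto_one_div_add_atTop_nhds_zero_nat.const_mul _).const_add _ |>.pow r).const_mul _
  have hle : (N : ℝ) ≤ (e : ℝ) * (q + (c + r) * 0) ^ r := by
    refine ge_of_tendsto' hlim fun m => ?_
    have hm : (0 : ℝ) < (m : ℝ) + 1 := by positivity
    have h1 : (N : ℝ) * (m + 1) ^ r ≤ e * (q * m + c + r) ^ r := by exact_mod_cast h' m
    have h2 : (q : ℝ) * m + c + r ≤ (q + (c + r) * (1 / ((m : ℝ) + 1))) * (m + 1) := by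
      have : (q + (c + r) * (1 / ((m : ℝ) + 1))) * (m + 1) = q * m + q + (c + r) := by
        field_simp
      rw [this]
      have : (0 : ℝ) ≤ q := by positivity
      linarith
    refine le_of_mul_le_mul_right ?_ (pow_pos hm r)
    rw [mul_assoc, ← mul_pow]
    exact h1.trans (by gcongr)
  have : (N : ℝ) ≤ ((e * q ^ r : ℕ) : ℝ) := by simpa using hle
  exact_mod_cast this

section Grid

variable {σ K : Type*} [Field K] [Fintype K]

/-- The ideal generated by the polynomials `X i ^ q - X i`. -/
noncomputable def frobIdeal (σ K : Type*) [Field K] [Fintype K] : Ideal (MvPolynomial σ K) :=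
  Ideal.span (Set.range fun i => X i ^ Fintype.card K - X i)

theorem restrictTotalDegree_sup_frobIdeal (n : ℕ) :
    restrictTotalDegree (Fin n) K (n * Fintype.card K) ⊔
      (frobIdeal (Fin n) K).restrictScalars K = ⊤ := by
  set S := restrictTotalDegree (Fin n) K (n * Fintype.card K) ⊔
      (frobIdeal (Fin n) K).restrictScalars K
  have hq := Fintype.one_lt_card (α := K)
  have key : ∀ d, ∀ u : Fin n →₀ ℕ, u.degree = d → monomial u (1 : K) ∈ S := by
    intro d
    induction d using Nat.strong_induction_on with
    | _ d ih =>
      intro u hu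
      by_cases h : ∀ i, u i ≤ Fintype.card K
      · refine Submodule.mem_sup_left ?_
        rw [mem_restrictTotalDegree]
        refine (totalDegree_monomial_le _ _).trans ?_
        change u.degree ≤ _
        rw [Finsupp.degree_eq_sum]
        simpa using Finset.sum_le_card_nsmul Finset.univ u _ fun i _ => h i
      · push Not at h
        obtain ⟨i, hi⟩ := h
        obtain ⟨v, rfl⟩ : ∃ v, u = v + Finsupp.single i (Fintype.card K) :=
          ⟨u - Finsupp.single i (Fintype.card K), by
            rw [tsub_add_cancel_of_le]; simpa using hi.le⟩
        have h1 : monomial (v + Finsupp.single i (Fintype.card K)) (1 : K) =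
            monomial v 1 * (X i ^ Fintype.card K - X i) +
              monomial (v + Finsupp.single i 1) (1 : K) := by
          rw [mul_sub, X_pow_eq_monomial, monomial_mul, X, monomial_mul]
          simp
        rw [h1]
        refine add_mem (Submodule.mem_sup_right ?_) (ih _ ?_ _ rfl)
        · exact Ideal.mul_mem_left _ _ (Ideal.subset_span ⟨i, rfl⟩)
        · rw [← hu]
          simp
          omega
  rw [eq_top_iff]
  intro p _
  rw [p.as_sum]
  refine sum_mem fun u _ => ?_
  rw [← mul_one (coeff u p), ← smul_eq_mul, ← smul_monomial]
  exact S.smul_mem _ (key _ u rfl)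

theorem frobIdeal_pow_le (n k : ℕ) :
    (frobIdeal (Fin n) K ^ k).restrictScalars K ≤
      restrictTotalDegree (Fin n) K (n * Fintype.card K + k * Fintype.card K) ⊔
      (frobIdeal (Fin n) K ^ (k + 1)).restrictScalars K := by
  have hq := Fintype.one_lt_card (α := K)
  induction k with
  | zero => simp [restrictTotalDegree_sup_frobIdeal]
  | succ k ih =>
    intro p hp
    rw [Submodule.restrictScalars_mem, pow_succ, mul_comm] at hp
    refine Submodule.mul_induction_on hp (fun g hg => ?_) fun _ _ => add_mem
    rw [frobIdeal] at hg
    induction hg using Submodule.span_induction with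
    | zero => simp
    | add x y _ _ hx hy =>
      intro a ha
      rw [add_mul x y]
      exact add_mem (hx a ha) (hy a ha)
    | smul c x _ hx =>
      intro a ha
      rw [smul_eq_mul, mul_comm c, mul_assoc]
      exact hx _ (Ideal.mul_mem_left _ _ ha)
    | mem x hx =>
      obtain ⟨i, rfl⟩ := hx
      intro a ha
      obtain ⟨b, hb, c, hc, rfl⟩ := Submodule.mem_sup.1 (ih ha)
      rw [mul_add]
      refine add_mem (Submodule.mem_sup_left ?_) (Submodule.mem_sup_right ?_)
      · rw [mem_restrictTotalDegree] at hb ⊢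
        have h1 : (X i ^ Fintype.card K - X i : MvPolynomial (Fin n) K).totalDegree ≤
            Fintype.card K := by
          refine (totalDegree_sub _ _).trans (max_le ?_ ?_)
          · rw [totalDegree_X_pow]
          · rw [totalDegree_X]
            exact hq.le
        refine (totalDegree_mul _ _).trans ((add_le_add h1 hb).trans (le_of_eq ?_))
        ring
      · rw [Submodule.restrictScalars_mem, pow_succ' _ (k + 1)]
        exact Ideal.mul_mem_mul (Ideal.subset_span ⟨i, rfl⟩) hc

theorem restrictTotalDegree_sup_frobIdeal_pow (n k : ℕ) :
    restrictTotalDegree (Fin n) K (n * Fintype.card K + k * Fintype.card K) ⊔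
      (frobIdeal (Fin n) K ^ (k + 1)).restrictScalars K = ⊤ := by
  induction k with
  | zero => simp [restrictTotalDegree_sup_frobIdeal]
  | succ k ih =>
    rw [eq_top_iff, ← ih]
    refine sup_le (le_sup_of_le_left fun p hp => ?_) (frobIdeal_pow_le n (k + 1))
    rw [mem_restrictTotalDegree] at hp ⊢
    exact hp.trans (by gcongr; omega)

end Grid

section Points

variable {σ K : Type*} [Field K]

/-- The translation `p(x) ↦ p(x + z)`. -/
noncomputable def shift (z : σ → K) : MvPolynomial σ K →ₐ[K] MvPolynomial σ K :=
  aeval fun i => X i + C (z i)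

theorem shift_comp_neg (z : σ → K) (p : MvPolynomial σ K) :
    shift (-z) (shift z p) = p := by
  have : (shift (-z)).comp (shift z) = AlgHom.id K (MvPolynomial σ K) := by
    ext i : 1
    simp [shift]
  exact DFunLike.congr_fun this p

theorem shift_injective (z : σ → K) : Function.Injective (shift z) :=
  Function.LeftInverse.injective (shift_comp_neg z)

theorem shift_surjective (z : σ → K) : Function.Surjective (shift z) := fun p =>
  ⟨shift (-z) p, by simpa using shift_comp_neg (-z) p⟩

theorem mem_idealOfVars_iff_eval {p : MvPolynomial σ K} :
    p ∈ idealOfVars σ K ↔ eval 0 p = 0 := by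
  rw [← pow_one (idealOfVars σ K), mem_pow_idealOfVars_iff', eval_zero, constantCoeff_eq]
  simp [Finsupp.degree_eq_zero_iff]

theorem shift_mem_idealOfVars {z : σ → K} {p : MvPolynomial σ K} :
    shift z p ∈ idealOfVars σ K ↔ eval z p = 0 := by
  have : (aeval (0 : σ → K)).comp (shift z) = aeval (R := K) z := by
    ext i
    simp [shift]
  rw [mem_idealOfVars_iff_eval]
  have h := DFunLike.congr_fun this p
  rw [AlgHom.comp_apply] at h
  exact h ▸ Iff.rfl

/-- The polynomials vanishing at `z`. -/
noncomputable def pointIdeal (z : σ → K) : Ideal (MvPolynomial σ K) :=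
  (idealOfVars σ K).comap (shift z)

theorem mem_pointIdeal {z : σ → K} {p : MvPolynomial σ K} : p ∈ pointIdeal z ↔ eval z p = 0 :=
  shift_mem_idealOfVars

theorem isCoprime_pointIdeal {z w : σ → K} (h : z ≠ w) :
    IsCoprime (pointIdeal z) (pointIdeal w) := by
  obtain ⟨i, hi⟩ := Function.ne_iff.1 h
  rw [Ideal.isCoprime_iff_exists]
  refine ⟨C (w i - z i)⁻¹ * (X i - C (z i)), ?_, C (w i - z i)⁻¹ * (C (w i) - X i), ?_, ?_⟩
  · simp [mem_pointIdeal]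
  · simp [mem_pointIdeal]
  · rw [← mul_add, sub_add_sub_cancel', ← C_sub, ← C_mul, inv_mul_cancel₀, C_1]
    exact sub_ne_zero.2 hi.symm

theorem frobIdeal_le_pointIdeal [Fintype K] (z : σ → K) : frobIdeal σ K ≤ pointIdeal z := by
  rw [frobIdeal, Ideal.span_le]
  rintro _ ⟨i, rfl⟩
  simp [mem_pointIdeal, FiniteField.pow_card]

/-- The polynomials lying in the ideal `(F₁, F₂)` up to terms of order `k` at `z`. -/
noncomputable def jetIdeal (F₁ F₂ : MvPolynomial σ K) (z : σ → K) (k : ℕ) :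
    Ideal (MvPolynomial σ K) :=
  Ideal.span {F₁, F₂} ⊔ pointIdeal z ^ k

theorem le_finrank_quotient_jetIdeal {r μ ν : ℕ} {F₁ F₂ : MvPolynomial (Fin (r + 2)) K}
    {z : Fin (r + 2) → K} (hμ : HasOrder (shift z F₁) μ) (hν : HasOrder (shift z F₂) ν)
    (h₁ : eval z F₁ = 0) (h₂ : eval z F₂ = 0) (m : ℕ)
    [Module.Finite K (_ ⧸ jetIdeal F₁ F₂ z (m + μ + ν + 1))] :
    (m + r).choose r ≤ Module.finrank K (_ ⧸ jetIdeal F₁ F₂ z (m + μ + ν + 1)) := by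
  set W := principalImage (shift z F₁) (m + μ + ν + 1) ⊔
    principalImage (shift z F₂) (m + μ + ν + 1) with hW
  let ψ := W.mkQ ∘ₗ (powVars _ K (m + μ + ν + 1)).mkQ ∘ₗ (shift z).toLinearMap
  have hψ : Function.Surjective ψ :=
    W.mkQ_surjective.comp ((Submodule.mkQ_surjective _).comp (shift_surjective z))
  have hker : (jetIdeal F₁ F₂ z (m + μ + ν + 1)).restrictScalars K ≤ LinearMap.ker ψ := by
    intro p hp
    obtain ⟨x, hx, y, hy, rfl⟩ := Submodule.mem_sup.1 (Submodule.restrictScalars_mem K _ _ |>.1 hp)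
    obtain ⟨a, b, rfl⟩ := Ideal.mem_span_pair.1 hx
    have hy' : shift z y ∈ powVars _ K (m + μ + ν + 1) := Ideal.le_comap_pow _ _ hy
    simp only [ψ, LinearMap.mem_ker, LinearMap.comp_apply, AlgHom.toLinearMap_apply, map_add,
      Submodule.mkQ_apply]
    rw [(Submodule.Quotient.mk_eq_zero _).2 hy', Submodule.Quotient.mk_zero, add_zero,
      ← Submodule.Quotient.mk_add, Submodule.Quotient.mk_eq_zero]
    refine add_mem (Submodule.mem_sup_left ⟨shift z a, ?_⟩)
      (Submodule.mem_sup_right ⟨shift z b, ?_⟩)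
    · simp [mul_comm]
    · simp [mul_comm]
  have hle : Module.finrank K (_ ⧸ W) ≤
      Module.finrank K (_ ⧸ jetIdeal F₁ F₂ z (m + μ + ν + 1)) :=
    LinearMap.finrank_le_finrank_of_surjective
      (f := ((jetIdeal F₁ F₂ z (m + μ + ν + 1)).restrictScalars K).liftQ ψ hker)
      fun y => (hψ y).imp' (Submodule.Quotient.mk) fun _ h => h
  have h3 := le_finrank_quotient_principalImage hμ hν m
  have h4 := le_choose_second_difference r m (hμ.pos (shift_mem_idealOfVars.2 h₁))
    (hν.pos (shift_mem_idealOfVars.2 h₂))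
  rw [← hW] at h3
  omega

theorem card_mul_choose_le [Fintype K] {r d₁ d₂ : ℕ} {F₁ F₂ : MvPolynomial (Fin (r + 2)) K}
    (hF₁ : F₁ ≠ 0) (hF₂ : F₂ ≠ 0) (hd₁ : F₁.totalDegree = d₁) (hd₂ : F₂.totalDegree = d₂)
    (hcop : IsRelPrime F₁ F₂) :
    ∃ c, ∀ m, Set.ncard {x | eval x F₁ = 0 ∧ eval x F₂ = 0} * (m + r).choose r ≤
      d₁ * d₂ * (Fintype.card K * m + c + r).choose r := by
  classical
  choose μ hμ using fun z => exists_hasOrder ((map_ne_zero_iff _ (shift_injective z)).2 hF₁)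
  choose ν hν using fun z => exists_hasOrder ((map_ne_zero_iff _ (shift_injective z)).2 hF₂)
  set B := ∑ z, (μ z + ν z)
  set q := Fintype.card K
  set Z := {x | eval x F₁ = 0 ∧ eval x F₂ = 0}
  refine ⟨(r + 2) * q + B * q + d₁ + d₂, fun m => ?_⟩
  let Q (z : Z) := jetIdeal F₁ F₂ z (m + μ z + ν z + 1)
  let Φ : MvPolynomial (Fin (r + 2)) K →ₗ[K] ∀ z, _ ⧸ Q z :=
    LinearMap.pi fun z => ((Q z).mkQ.restrictScalars K)
  have hQ : Pairwise (Function.onFun IsCoprime Q) := by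
    intro z w hzw
    have h := (isCoprime_pointIdeal (Subtype.coe_ne_coe.2 hzw)).pow
      (m := m + μ z + ν z + 1) (n := m + μ w + ν w + 1)
    rw [Ideal.isCoprime_iff_sup_eq] at h
    rw [Function.onFun, Ideal.isCoprime_iff_sup_eq, eq_top_iff, ← h]
    exact sup_le_sup le_sup_right le_sup_right
  have hsurj : Function.Surjective Φ := Ideal.pi_mkQ_surjective hQ
  have hfrob : (frobIdeal (Fin (r + 2)) K ^ (m + B + 1)).restrictScalars K ≤ LinearMap.ker Φ := by
    intro p hp
    rw [LinearMap.mem_ker]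
    funext z
    refine (Submodule.Quotient.mk_eq_zero _).2 (Ideal.mem_sup_right ?_)
    have hB : μ z + ν z ≤ B :=
      Finset.single_le_sum (f := fun z : Fin (r + 2) → K => μ z + ν z)
        (fun _ _ => Nat.zero_le _) (Finset.mem_univ z.1)
    exact Ideal.pow_right_mono (frobIdeal_le_pointIdeal z.1) _
      (Ideal.pow_le_pow_right (by omega) hp)
  set k := (r + 2) * q + (m + B) * q
  have hmap : (restrictTotalDegree (Fin (r + 2)) K (k + d₁ + d₂)).map Φ = ⊤ := by
    have hle : restrictTotalDegree (Fin (r + 2)) K k ≤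
        restrictTotalDegree (Fin (r + 2)) K (k + d₁ + d₂) := fun p hp => by
      rw [mem_restrictTotalDegree] at hp ⊢
      omega
    rw [eq_top_iff]
    calc ⊤ = Submodule.map Φ ⊤ := by rw [Submodule.map_top, LinearMap.range_eq_top.2 hsurj]
      _ ≤ _ := by
        rw [← restrictTotalDegree_sup_frobIdeal_pow (r + 2) (m + B), Submodule.map_sup]
        exact sup_le (Submodule.map_mono hle)
          ((Submodule.map_le_iff_le_comap.2 hfrob).trans (by simp))
  have hfin : Module.Finite K (∀ z, _ ⧸ Q z) := by
    rw [Module.finite_def, ← hmap]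
    exact (Module.Finite.iff_fg.1 inferInstance).map Φ
  have (z : Z) : Module.Finite K (_ ⧸ Q z) :=
    Module.Finite.of_surjective (LinearMap.proj z : (∀ z, _ ⧸ Q z) →ₗ[K] _)
      (LinearMap.proj_surjective z)
  have h₁ := finrank_add_le_of_isRelPrime hF₁ hF₂ hd₁ hd₂ hcop Φ
    (fun a => funext fun z => (Submodule.Quotient.mk_eq_zero _).2
      (Ideal.mem_sup_left (Ideal.mul_mem_right _ _ (Ideal.subset_span (by simp)))))
    (fun a => funext fun z => (Submodule.Quotient.mk_eq_zero _).2
      (Ideal.mem_sup_left (Ideal.mul_mem_right _ _ (Ideal.subset_span (by simp))))) k hmap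
  have h₂ := choose_second_difference_le r k d₁ d₂
  have h₃ : Z.ncard * (m + r).choose r ≤ Module.finrank K (∀ z, _ ⧸ Q z) := by
    rw [Module.finrank_pi_fintype, ← Nat.card_coe_set_eq, Nat.card_eq_fintype_card,
      ← Finset.card_univ, ← smul_eq_mul]
    exact Finset.card_nsmul_le_sum _ _ _ fun z _ =>
      le_finrank_quotient_jetIdeal (hμ z) (hν z) z.2.1 z.2.2 m
  have h₄ : k + d₁ + d₂ + r = q * m + ((r + 2) * q + B * q + d₁ + d₂) + r := by
    simp only [k]
    ring
  rw [← h₄]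
  omega

theorem isRelPrime_of_map {L : Type*} [Field L] (f : K →+* L) {F₁ F₂ : MvPolynomial σ K}
    (h : IsRelPrime (map f F₁) (map f F₂)) : IsRelPrime F₁ F₂ := by
  intro D h₁ h₂
  have hu := h (map_dvd (map f) h₁) (map_dvd (map f) h₂)
  rw [isUnit_iff_totalDegree_of_isReduced] at hu ⊢
  rwa [coeff_map, isUnit_map_iff, totalDegree, support_map_of_injective D f.injective] at hu

end Points

/-- **Lemma 2.** If `F₁, F₂` are non-zero polynomials over `𝔽_q` of degrees `d₁, d₂` in
`n ≥ 2` variables with no common non-unit factor over the algebraic closure `𝔽̄_q`, then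
the number of common `𝔽_q`-zeros of `F₁` and `F₂` is at most `d₁ d₂ q^{n-2}`. -/
theorem common_zeros_le_of_coprime
    {K : Type*} [Field K] [Fintype K] {n : ℕ} (hn : 2 ≤ n)
    {d₁ d₂ : ℕ} (F₁ F₂ : MvPolynomial (Fin n) K)
    (hF₁ : F₁ ≠ 0) (hF₂ : F₂ ≠ 0)
    (hd₁ : F₁.totalDegree = d₁) (hd₂ : F₂.totalDegree = d₂)
    (hcop : ∀ D : MvPolynomial (Fin n) (AlgebraicClosure K),
      D ∣ MvPolynomial.map (algebraMap K (AlgebraicClosure K)) F₁ →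
      D ∣ MvPolynomial.map (algebraMap K (AlgebraicClosure K)) F₂ → IsUnit D) :
    Set.ncard {x : Fin n → K | eval x F₁ = 0 ∧ eval x F₂ = 0} ≤
      d₁ * d₂ * Fintype.card K ^ (n - 2) := by
  obtain ⟨r, rfl⟩ : ∃ r, n = r + 2 := ⟨n - 2, by omega⟩
  obtain ⟨c, hc⟩ := card_mul_choose_le hF₁ hF₂ hd₁ hd₂
    (isRelPrime_of_map _ fun D h₁ h₂ => hcop D h₁ h₂)
  exact le_mul_pow_of_forall_choose_le hc
end
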